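/- Let n ≥ 2 and let μ be a locally finite Borel measure on ℝ^n. If μ is 1-rectifiable, then the density-normalized L² Jones function satisfies J̃₂(μ,x) < ∞ at μ-almost every x ∈ ℝ^n. -/

import Mathlib

open MeasureTheory Metric Set Filter
open scoped ENNReal NNReal Topology

noncomputable section

/-- The closed dyadic cube in `ℝⁿ` of generation `k` (side length `2^(-k)`) with corner `z`. -/
def dyadicCube (n : ℕ) (k : ℤ) (z : Fin n → ℤ) : Set (EuclideanSpace ℝ (Fin n)) :=
  {x | ∀ i, (z i : ℝ) * (2 : ℝ) ^ (-k) ≤ x i ∧ x i ≤ ((z i : ℝ) + 1) * (2 : ℝ) ^ (-k)}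

/-- The concentric dilate `λQ` of the dyadic cube `Q` of generation `k` with corner `z`. -/
def dilatedCube (n : ℕ) (lam : ℝ) (k : ℤ) (z : Fin n → ℤ) : Set (EuclideanSpace ℝ (Fin n)) :=
  {x | ∀ i, |x i - ((z i : ℝ) + 1 / 2) * (2 : ℝ) ^ (-k)| ≤ lam * (2 : ℝ) ^ (-k) / 2}

/-- The axis-parallel cube with center `c` and side length `s`. -/
def axisCube {n : ℕ} (c : EuclideanSpace ℝ (Fin n)) (s : ℝ) : Set (EuclideanSpace ℝ (Fin n)) :=
  {x | ∀ i, |x i - c i| ≤ s / 2}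

/-- `L` is an (affine) line in `ℝⁿ`. -/
def IsLine {n : ℕ} (L : Set (EuclideanSpace ℝ (Fin n))) : Prop :=
  ∃ p v : EuclideanSpace ℝ (Fin n), v ≠ 0 ∧ L = {x | ∃ t : ℝ, x = p + t • v}

/-- `β₂(μ,Q)²`, the square of the `L²` beta number of `μ` on `Q`:
`inf_ℓ ∫_Q (dist(x,ℓ)/diam Q)² dμ(x)/μ(Q)`. When `μ Q = 0` this equals `0`,
since `0/0 = 0` in `ℝ≥0∞`. -/
def beta2Sq {n : ℕ} (μ : Measure (EuclideanSpace ℝ (Fin n)))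
    (Q : Set (EuclideanSpace ℝ (Fin n))) : ℝ≥0∞ :=
  ⨅ (L : Set (EuclideanSpace ℝ (Fin n))) (_ : IsLine L),
    (∫⁻ x in Q, ENNReal.ofReal ((Metric.infDist x L / Metric.diam Q) ^ 2) ∂μ) / μ Q

/-- The beta number `β_E(Q) = inf_ℓ sup_{x ∈ E ∩ Q} dist(x,ℓ)/diam Q` of a set `E`;
it is `0` when `E ∩ Q = ∅`. -/
def betaSet {n : ℕ} (E Q : Set (EuclideanSpace ℝ (Fin n))) : ℝ≥0∞ :=
  ⨅ (L : Set (EuclideanSpace ℝ (Fin n))) (_ : IsLine L),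
    ⨆ x ∈ E ∩ Q, ENNReal.ofReal (Metric.infDist x L / Metric.diam Q)

-- The ordinary `L²` Jones function at scale `r`:
-- `J₂(μ,r,x) = Σ_Q β₂²(μ,3Q) χ_Q(x)` over dyadic cubes `Q` of side length at most `r`.
open Classical in
def jones2 {n : ℕ} (μ : Measure (EuclideanSpace ℝ (Fin n))) (r : ℝ)
    (x : EuclideanSpace ℝ (Fin n)) : ℝ≥0∞ :=
  ∑' (k : ℤ) (z : Fin n → ℤ),
    if (2 : ℝ) ^ (-k) ≤ r ∧ x ∈ dyadicCube n k z then beta2Sq μ (dilatedCube n 3 k z) else 0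

-- The density-normalized `L²` Jones function at scale `r`:
-- `J̃₂(μ,r,x) = Σ_Q β₂²(μ,3Q) (diam Q / μ(Q)) χ_Q(x)` over dyadic cubes `Q` of side length
-- at most `r`, with the convention `0/0 = 0` (the term vanishes when `μ Q = 0`).
open Classical in
def jones2Tilde {n : ℕ} (μ : Measure (EuclideanSpace ℝ (Fin n))) (r : ℝ)
    (x : EuclideanSpace ℝ (Fin n)) : ℝ≥0∞ :=
  ∑' (k : ℤ) (z : Fin n → ℤ),
    if (2 : ℝ) ^ (-k) ≤ r ∧ x ∈ dyadicCube n k z then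
      (if μ (dyadicCube n k z) = 0 then 0
       else beta2Sq μ (dilatedCube n 3 k z) * ENNReal.ofReal (Metric.diam (dyadicCube n k z))
              / μ (dyadicCube n k z))
    else 0

/-- A measure `μ` on `ℝⁿ` is `1`-rectifiable: countably many bounded Borel sets `Eᵢ ⊆ ℝ` and
Lipschitz maps `fᵢ : Eᵢ → ℝⁿ` whose images carry the full mass of `μ`. -/
def Is1Rectifiable {n : ℕ} (μ : Measure (EuclideanSpace ℝ (Fin n))) : Prop :=
  ∃ (E : ℕ → Set ℝ) (f : ℕ → ℝ → EuclideanSpace ℝ (Fin n)),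
    (∀ i, Bornology.IsBounded (E i) ∧ MeasurableSet (E i) ∧
      ∃ K : ℝ≥0, LipschitzOnWith K (f i) (E i)) ∧
    μ (Set.univ \ ⋃ i, f i '' E i) = 0

/-- A measure `μ` on `ℝⁿ` is `m`-rectifiable: countably many bounded Borel sets `Eᵢ ⊆ ℝᵐ` and
Lipschitz maps `fᵢ : Eᵢ → ℝⁿ` whose images carry the full mass of `μ`. -/
def IsMRectifiable (m : ℕ) {n : ℕ} (μ : Measure (EuclideanSpace ℝ (Fin n))) : Prop :=
  ∃ (E : ℕ → Set (EuclideanSpace ℝ (Fin m)))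
    (f : ℕ → EuclideanSpace ℝ (Fin m) → EuclideanSpace ℝ (Fin n)),
    (∀ i, Bornology.IsBounded (E i) ∧ MeasurableSet (E i) ∧
      ∃ K : ℝ≥0, LipschitzOnWith K (f i) (E i)) ∧
    μ (Set.univ \ ⋃ i, f i '' E i) = 0

/-- A rectifiable curve in `ℝⁿ`: the image of a Lipschitz map on a compact interval. -/
def IsRectifiableCurve {n : ℕ} (Γ : Set (EuclideanSpace ℝ (Fin n))) : Prop :=
  ∃ (f : ℝ → EuclideanSpace ℝ (Fin n)) (a b : ℝ) (K : ℝ≥0),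
    LipschitzOnWith K f (Set.Icc a b) ∧ Γ = f '' Set.Icc a b

/-- The lower Hausdorff `1`-density `Θ¹_*(μ,x) = liminf_{r→0⁺} μ(B(x,r))/(2r)`. -/
def lowerDensity1 {n : ℕ} (μ : Measure (EuclideanSpace ℝ (Fin n)))
    (x : EuclideanSpace ℝ (Fin n)) : ℝ≥0∞ :=
  Filter.liminf (fun r : ℝ => μ (Metric.closedBall x r) / ENNReal.ofReal (2 * r)) (𝓝[>] 0)

/-- The upper Hausdorff `1`-density `Θ*¹(μ,x) = limsup_{r→0⁺} μ(B(x,r))/(2r)`. -/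
def upperDensity1 {n : ℕ} (μ : Measure (EuclideanSpace ℝ (Fin n)))
    (x : EuclideanSpace ℝ (Fin n)) : ℝ≥0∞ :=
  Filter.limsup (fun r : ℝ => μ (Metric.closedBall x r) / ENNReal.ofReal (2 * r)) (𝓝[>] 0)

/-- The lower Hausdorff `m`-density `Θᵐ_*(μ,x) = liminf_{r→0⁺} μ(B(x,r))/(ω_m rᵐ)`, where
`ω_m` is the Lebesgue volume of the unit ball in `ℝᵐ`. -/
def lowerDensity (m : ℕ) {n : ℕ} (μ : Measure (EuclideanSpace ℝ (Fin n)))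
    (x : EuclideanSpace ℝ (Fin n)) : ℝ≥0∞ :=
  Filter.liminf
    (fun r : ℝ => μ (Metric.closedBall x r) /
      (MeasureTheory.volume (Metric.ball (0 : EuclideanSpace ℝ (Fin m)) 1) *
        ENNReal.ofReal (r ^ m)))
    (𝓝[>] 0)

/-- The `δ`-packing prenumber `P^s_δ(A)`: the supremum of `Σᵢ (2rᵢ)^s` over all countable
packings of `A` by disjoint closed balls centered in `A` of diameter at most `δ`. -/
def packingPreAt {X : Type*} [PseudoMetricSpace X] (s δ : ℝ) (A : Set X) : ℝ≥0∞ :=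
  ⨆ (S : Set (X × ℝ)) (_ : S.Countable)
    (_ : ∀ p ∈ S, p.1 ∈ A ∧ 0 < p.2 ∧ 2 * p.2 ≤ δ)
    (_ : S.Pairwise fun p q => Disjoint (Metric.closedBall p.1 p.2) (Metric.closedBall q.1 q.2)),
    ∑' p : S, ENNReal.ofReal ((2 * p.1.2) ^ s)

/-- The `s`-dimensional packing premeasure `P^s(A) = lim_{δ→0⁺} P^s_δ(A)`; since `P^s_δ(A)`
is nonincreasing in `δ`, the limit equals the infimum over `δ > 0`. -/
def packingPre {X : Type*} [PseudoMetricSpace X] (s : ℝ) (A : Set X) : ℝ≥0∞ :=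
  ⨅ (δ : ℝ) (_ : 0 < δ), packingPreAt s δ A

/-- The `s`-dimensional packing measure
`𝒫^s(A) = inf { Σᵢ P^s(Aᵢ) : A = ⋃ᵢ Aᵢ }`. -/
def packingMeasure {X : Type*} [PseudoMetricSpace X] (s : ℝ) (A : Set X) : ℝ≥0∞ :=
  ⨅ (F : ℕ → Set X) (_ : A = ⋃ i, F i), ∑' i, packingPre s (F i)

theorem exists_Icc_crossing {g : ℝ → ℝ} (hg : Continuous g) {t₀ t₁ α β : ℝ} (ht : t₀ ≤ t₁)
    (hαβ : α ≤ β) (h₀ : g t₀ ≤ α) (h₁ : β ≤ g t₁) :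
    ∃ τ τ', t₀ ≤ τ ∧ τ ≤ τ' ∧ τ' ≤ t₁ ∧ g τ = α ∧ g τ' = β ∧
      ∀ s ∈ Icc τ τ', α ≤ g s ∧ g s ≤ β := by
  obtain ⟨τ', ⟨hτ', hgτ'⟩, hmin⟩ : ∃ τ', IsLeast (Icc t₀ t₁ ∩ g ⁻¹' Ici β) τ' :=
    (isCompact_Icc.inter_right (isClosed_Ici.preimage hg)).exists_isLeast
      ⟨t₁, right_mem_Icc.2 ht, h₁⟩
  have hβ : ∀ s, t₀ ≤ s → s ≤ τ' → g s ≤ β := by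
    intro s hs hs'
    by_contra hc
    push Not at hc
    obtain ⟨r, hr, hgr⟩ := intermediate_value_Icc hs hg.continuousOn
      (show β ∈ Icc (g t₀) (g s) from ⟨h₀.trans hαβ, hc.le⟩)
    have h1 : τ' ≤ r := hmin ⟨⟨hr.1, hr.2.trans (hs'.trans hτ'.2)⟩, hgr.ge⟩
    have h2 : r = s := le_antisymm hr.2 (hs'.trans h1)
    exact absurd hgr (by rw [h2]; exact hc.ne')
  obtain ⟨τ, ⟨hτ, hgτ⟩, hmax⟩ : ∃ τ, IsGreatest (Icc t₀ τ' ∩ g ⁻¹' Iic α) τ :=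
    (isCompact_Icc.inter_right (isClosed_Iic.preimage hg)).exists_isGreatest
      ⟨t₀, left_mem_Icc.2 hτ'.1, h₀⟩
  have hτβ : g τ' = β := le_antisymm (hβ _ hτ'.1 le_rfl) hgτ'
  have hα : ∀ s, τ ≤ s → s ≤ τ' → α ≤ g s := by
    intro s hs hs'
    by_contra hc
    push Not at hc
    obtain ⟨r, hr, hgr⟩ := intermediate_value_Icc hs' hg.continuousOn
      (show α ∈ Icc (g s) (g τ') from ⟨hc.le, by rw [hτβ]; exact hαβ⟩)
    have h1 : r ≤ τ := hmax ⟨⟨hτ.1.trans (hs.trans hr.1), hr.2⟩, hgr.le⟩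
    have h2 : r = s := le_antisymm (h1.trans hs) hr.1
    exact absurd hgr (by rw [h2]; exact hc.ne)
  exact ⟨τ, τ', hτ.1, hτ.2, hτ'.2, le_antisymm hgτ (hα _ le_rfl hτ.2), hτβ,
    fun s hs => ⟨hα s hs.1 hs.2, hβ s (hτ.1.trans hs.1) hs.2⟩⟩

theorem exists_uIcc_crossing {g : ℝ → ℝ} (hg : Continuous g) {t₀ t₁ α β : ℝ}
    (hαβ : α ≤ β) (h₀ : g t₀ ≤ α) (h₁ : β ≤ g t₁) :
    ∃ τ τ', uIcc τ τ' ⊆ uIcc t₀ t₁ ∧ g τ = α ∧ g τ' = β ∧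
      ∀ s ∈ uIcc τ τ', α ≤ g s ∧ g s ≤ β := by
  rcases le_total t₀ t₁ with ht | ht
  · obtain ⟨τ, τ', h1, h2, h3, h4, h5, h6⟩ := exists_Icc_crossing hg ht hαβ h₀ h₁
    refine ⟨τ, τ', ?_, h4, h5, by rwa [uIcc_of_le h2]⟩
    rw [uIcc_of_le h2, uIcc_of_le ht]
    exact Icc_subset_Icc h1 h3
  · obtain ⟨τ, τ', h1, h2, h3, h4, h5, h6⟩ :=
      exists_Icc_crossing (g := fun t => g (-t)) (hg.comp continuous_neg) (neg_le_neg ht) hαβ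
        (by simpa using h₀) (by simpa using h₁)
    refine ⟨-τ, -τ', ?_, h4, h5, ?_⟩
    · rw [uIcc_of_ge (by linarith), uIcc_of_ge ht]
      exact Icc_subset_Icc (by linarith) (by linarith)
    · intro s hs
      rw [uIcc_of_ge (by linarith)] at hs
      simpa using h6 (-s) ⟨by linarith [hs.2], by linarith [hs.1]⟩

/-- Lower bound for the number of points at which `g` takes the value `c` on `[a, b]`, obtained by
counting the pieces of a partition into `m + 1` equal intervals on which the value is attained. -/
def partitionCount (g : ℝ → ℝ) (a b : ℝ) (m : ℕ) (c : ℝ) : ℝ≥0∞ :=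
  ∑ i ∈ Finset.range (m + 1),
    (g '' Icc (a + i * ((b - a) / (m + 1))) (a + (i + 1) * ((b - a) / (m + 1)))).indicator 1 c

theorem measurable_partitionCount {g : ℝ → ℝ} (hg : Continuous g) (a b : ℝ) (m : ℕ) :
    Measurable (partitionCount g a b m) := by
  unfold partitionCount
  refine Finset.measurable_sum _ fun i _ => ?_
  exact measurable_one.indicator (isCompact_Icc.image hg).isClosed.measurableSet

theorem lintegral_partitionCount_le {g : ℝ → ℝ} {K : ℝ≥0} (hg : LipschitzWith K g) (a b : ℝ)
    (m : ℕ) :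
    ∫⁻ c, partitionCount g a b m c ≤ ENNReal.ofReal (K * (b - a)) := by
  unfold partitionCount
  have hm : (0 : ℝ) < m + 1 := by positivity
  rw [lintegral_finsetSum]
  swap
  · intro i _
    exact measurable_one.indicator (isCompact_Icc.image hg.continuous).isClosed.measurableSet
  have key : ∀ i ∈ Finset.range (m + 1), ∫⁻ c, (g '' Icc (a + i * ((b - a) / (m + 1)))
      (a + (i + 1) * ((b - a) / (m + 1)))).indicator 1 c
        ≤ ENNReal.ofReal (K * ((b - a) / (m + 1))) := by
    intro i _
    rw [lintegral_indicator_one (isCompact_Icc.image hg.continuous).isClosed.measurableSet]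
    refine (Real.volume_le_diam _).trans ?_
    refine (hg.ediam_image_le _).trans ?_
    rw [Real.ediam_Icc, ← ENNReal.ofReal_coe_nnreal, ← ENNReal.ofReal_mul K.coe_nonneg]
    apply ENNReal.ofReal_le_ofReal
    apply le_of_eq
    ring
  refine (Finset.sum_le_sum key).trans ?_
  rw [Finset.sum_const, Finset.card_range, nsmul_eq_mul, ← ENNReal.ofReal_natCast,
    ← ENNReal.ofReal_mul (by positivity)]
  apply ENNReal.ofReal_le_ofReal
  push_cast
  apply le_of_eq
  field_simp

theorem eventually_card_le_partitionCount {g : ℝ → ℝ} {a b c : ℝ} (hab : a < b) (T : Finset ℝ)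
    (hT : ∀ t ∈ T, t ∈ Icc a b ∧ g t = c) :
    ∀ᶠ m in atTop, (T.card : ℝ≥0∞) ≤ partitionCount g a b m c := by
  classical
  -- a positive lower bound for the gaps of `T`
  obtain ⟨δ, hδ, hgap⟩ : ∃ δ > 0, ∀ s ∈ T, ∀ t ∈ T, s ≠ t → δ ≤ |s - t| := by
    rcases (T : Set ℝ).subsingleton_or_nontrivial with hs | hs
    · exact ⟨1, one_pos, fun s h t h' hne => absurd (hs h h') hne⟩
    · refine ⟨(T : Set ℝ).infsep, (T.infsep_pos_iff_nontrivial).2 hs, fun s h t h' hne => ?_⟩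
      exact Set.infsep_le_dist_of_mem h h' hne
  have hlim : Tendsto (fun m : ℕ => (b - a) / ((m : ℝ) + 1)) atTop (𝓝 0) :=
    mod_cast (tendsto_const_div_atTop_nhds_zero_nat (b - a)).comp (tendsto_add_atTop_nat 1)
  filter_upwards [hlim.eventually (gt_mem_nhds hδ)] with m hm
  have hm1 : (0 : ℝ) < m + 1 := by positivity
  set h := (b - a) / ((m : ℝ) + 1) with hh
  have hpos : 0 < h := by rw [hh]; apply div_pos <;> linarith
  have hmh : (m + 1) * h = b - a := by rw [hh]; field_simp
  have hex : ∀ t ∈ T, ∃ i ∈ Finset.range (m + 1), t ∈ Icc (a + i * h) (a + (i + 1) * h) := by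
    intro t ht
    obtain ⟨⟨h1, h2⟩, -⟩ := hT t ht
    rcases h2.eq_or_lt with rfl | h2
    · exact ⟨m, by simp, by nlinarith, by linarith⟩
    · refine ⟨⌊(t - a) / h⌋₊, ?_, ?_, ?_⟩
      · rw [Finset.mem_range, Nat.floor_lt (by apply div_nonneg <;> linarith), div_lt_iff₀ hpos]
        push_cast
        linarith
      · have := Nat.floor_le (show 0 ≤ (t - a) / h by apply div_nonneg <;> linarith)
        rw [le_div_iff₀ hpos] at this
        linarith
      · have := Nat.lt_floor_add_one ((t - a) / h)
        rw [div_lt_iff₀ hpos] at this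
        linarith
  choose! φ hφ hφ' using hex
  have hinj : Set.InjOn φ T := by
    intro s hs t ht hst
    by_contra hne
    have h1 := hgap s hs t ht hne
    have h2 := hφ' s hs
    have h3 := hφ' t ht
    rw [← hst] at h3
    have : |s - t| ≤ h := by
      rw [abs_le]
      constructor <;> linarith [h2.1, h2.2, h3.1, h3.2]
    linarith
  unfold partitionCount
  rw [← hh, ← Finset.card_image_of_injOn hinj]
  calc ((T.image φ).card : ℝ≥0∞) = ∑ i ∈ T.image φ, 1 := by simp
    _ = ∑ i ∈ T.image φ, (g '' Icc (a + i * h) (a + (i + 1) * h)).indicator 1 c := by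
        refine Finset.sum_congr rfl fun i hi => ?_
        obtain ⟨t, ht, rfl⟩ := Finset.mem_image.1 hi
        have : c ∈ g '' Icc (a + φ t * h) (a + (φ t + 1) * h) := ⟨t, hφ' t ht, (hT t ht).2⟩
        rw [indicator_of_mem this]
        rfl
    _ ≤ _ := by
        refine Finset.sum_le_sum_of_subset ?_
        intro i hi
        obtain ⟨t, ht, rfl⟩ := Finset.mem_image.1 hi
        exact hφ t ht
set_option maxHeartbeats 1000000 in
theorem exists_coordinate_box {n : ℕ} {i₀ i₁ : Fin n} (hi : i₁ ≠ i₀) {p₀ β σ : ℝ} {d : Fin n → ℝ}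
    (hβ : 0 < β) (hβ' : β ≤ 7) (hp : |p₀| ≤ 7) (hσ : 1 ≤ σ) (hσ' : σ ≤ 11)
    (hd : 1 ≤ ∑ i, d i ^ 2) :
    ∃ z : Fin n → ℝ, ∀ u : Fin n → ℝ,
      (∀ i, |u i - z i| ≤ (if i = i₀ then β / 6000 else 1 / 512) / (4 * n)) →
      (∀ i, |u i| ≤ 60) ∧ σ * u i₀ / 4 ≤ p₀ * u i₀ + β * u i₁ ∧
        p₀ * u i₀ + β * u i₁ ≤ 3 * (σ * u i₀) / 4 ∧ β / 60 ≤ σ * u i₀ / 4 ∧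
        β / (24000 * n) ≤ |∑ i, d i * u i| := by
  have hn : (1 : ℝ) ≤ n := by exact_mod_cast i₀.pos
  set h : Fin n → ℝ := fun i => if i = i₀ then β / 6000 else 1 / 512 with hh
  have hh0 : h i₀ = β / 6000 := by simp [hh]
  have hh1 : ∀ i, i ≠ i₀ → h i = 1 / 512 := fun i hne => by simp [hh, hne]
  have hhβ : ∀ i, β / 6000 ≤ h i := by
    intro i
    by_cases hi0 : i = i₀
    · rw [hi0, hh0]
    · rw [hh1 i hi0]; linarith
  have hhpos : ∀ i, 0 < h i := fun i => lt_of_lt_of_le (by positivity) (hhβ i)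
  obtain ⟨ε, m, hm, hm', hε, hεm⟩ : ∃ ε m : ℝ, 1 / 8 ≤ m ∧ m ≤ 13 ∧ (ε = 1 ∨ ε = -1) ∧
      ∀ a v : ℝ, 0 ≤ a → a * m ≤ β * v → β * v ≤ a * (m + 1 / 8) →
        σ * a / 4 ≤ p₀ * a + β * (ε * v) ∧ p₀ * a + β * (ε * v) ≤ 3 * (σ * a) / 4 := by
    rw [abs_le] at hp
    rcases le_total 0 (σ / 2 - p₀) with hM | hM
    · refine ⟨1, σ / 2 - p₀ + 1 / 8, by linarith, by linarith, Or.inl rfl, fun a v ha h1 h2 => ?_⟩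
      constructor <;> nlinarith
    · refine ⟨-1, -(σ / 2 - p₀) + 1 / 8, by linarith, by linarith, Or.inr rfl,
        fun a v ha h1 h2 => ?_⟩
      constructor <;> nlinarith
  set a₀ := β * (257 / 256) / (m + 1 / 8) with ha₀
  have ham : a₀ * (m + 1 / 8) = β * (257 / 256) := by rw [ha₀]; field_simp
  have ha₀l : β / 14 ≤ a₀ := by
    rw [ha₀, div_le_div_iff₀ (by norm_num) (by linarith)]; nlinarith
  have ha₀u : a₀ ≤ 5 * β := by
    rw [ha₀, div_le_iff₀ (by linarith)]; nlinarith
  have hmm : (a₀ + β / 3000) * m ≤ β := by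
    have h1 : (a₀ + β / 3000) * m * (m + 1 / 8) ≤ β * (m + 1 / 8) := by
      have : (a₀ + β / 3000) * m * (m + 1 / 8) = β * (m * (257 / 256) + m * (m + 1 / 8) / 3000) := by
        linear_combination m * ham
      rw [this]
      apply mul_le_mul_of_nonneg_left _ hβ.le
      nlinarith
    exact le_of_mul_le_mul_right h1 (by linarith)
  set cen : Fin n → ℝ := fun i =>
    if i = i₀ then a₀ + β / 6000 else if i = i₁ then ε * (1 + 1 / 512) else 0 with hcen
  have hcen0 : cen i₀ = a₀ + β / 6000 := by simp [hcen]
  have hcen1 : cen i₁ = ε * (1 + 1 / 512) := by simp [hcen, hi]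
  have hcenb : ∀ i, |cen i| ≤ 36 := by
    intro i
    simp only [hcen]
    split_ifs
    · rw [abs_le]; constructor <;> linarith
    · rcases hε with rfl | rfl <;> norm_num [abs_le]
    · simp
  obtain ⟨k, -, hk⟩ := Finset.exists_max_image Finset.univ (fun i => h i * |d i|) ⟨i₀, by simp⟩
  have hw : β / (6000 * n) ≤ h k * |d k| := by
    obtain ⟨j, -, hj⟩ : ∃ j ∈ (Finset.univ : Finset (Fin n)), (1 : ℝ) / n ≤ d j ^ 2 := by
      apply Finset.exists_le_of_sum_le ⟨i₀, by simp⟩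
      simp only [Finset.sum_const, Finset.card_univ, Fintype.card_fin, nsmul_eq_mul]
      rwa [mul_one_div_cancel (by positivity)]
    have hj' : 1 / (n : ℝ) ≤ |d j| := by
      apply abs_le_of_sq_le_sq' _ (abs_nonneg _) |>.2
      rw [sq_abs]
      refine le_trans ?_ hj
      rw [div_pow, one_pow]
      exact one_div_le_one_div_of_le (by positivity) (by nlinarith)
    calc β / (6000 * n) = β / 6000 * (1 / n) := by field_simp
      _ ≤ h j * |d j| := mul_le_mul (hhβ j) hj' (by positivity) (hhpos j).le
      _ ≤ _ := hk j (by simp)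
  set S := ∑ i, d i * cen i with hS
  obtain ⟨δ, hδ, hSδ⟩ : ∃ δ : ℝ, |δ| = h k / 2 ∧ h k * |d k| / 2 ≤ |S + d k * δ| := by
    have hk0 := hhpos k
    by_cases hc : 0 ≤ S * d k
    · refine ⟨h k / 2, abs_of_pos (by positivity), ?_⟩
      apply abs_le_of_sq_le_sq' _ (abs_nonneg _) |>.2
      rw [sq_abs, div_pow, mul_pow, sq_abs]
      nlinarith [sq_nonneg S, mul_nonneg hc hk0.le]
    · push Not at hc
      refine ⟨-(h k / 2), by rw [abs_neg]; exact abs_of_pos (by positivity), ?_⟩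
      apply abs_le_of_sq_le_sq' _ (abs_nonneg _) |>.2
      rw [sq_abs, div_pow, mul_pow, sq_abs]
      nlinarith [sq_nonneg S, mul_nonneg (neg_nonneg.2 hc.le) hk0.le]
  have hn4 : 1 / (4 * (n : ℝ)) ≤ 1 / 4 := one_div_le_one_div_of_le (by norm_num) (by linarith)
  refine ⟨fun i => cen i + if i = k then δ else 0, fun u hu => ?_⟩
  have hu' : ∀ i, |u i - cen i| ≤ h i := by
    intro i
    have h1 := hu i
    change _ ≤ h i / (4 * n) at h1
    have h2 : |if i = k then δ else 0| ≤ h i / 2 := by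
      split_ifs with hik
      · rw [hδ, hik]
      · rw [abs_zero]; linarith [hhpos i]
    have h3 : h i / (4 * n) ≤ h i / 4 := by
      rw [div_eq_mul_one_div, div_eq_mul_one_div (h i) 4]
      exact mul_le_mul_of_nonneg_left hn4 (hhpos i).le
    calc |u i - cen i| = |(u i - (cen i + if i = k then δ else 0)) + if i = k then δ else 0| := by
          congr 1; ring
      _ ≤ _ := abs_add_le _ _
      _ ≤ h i / 4 + h i / 2 := add_le_add (h1.trans h3) h2
      _ ≤ h i := by linarith [hhpos i]
  have hu0 := hu' i₀
  rw [hcen0, hh0, abs_le] at hu0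
  have hu1 : 1 ≤ ε * u i₁ ∧ ε * u i₁ ≤ 257 / 256 := by
    have := hu' i₁
    rw [hcen1, hh1 _ hi, abs_le] at this
    rcases hε with rfl | rfl <;> constructor <;> linarith [this.1, this.2]
  have hεε : ε * (ε * u i₁) = u i₁ := by rcases hε with rfl | rfl <;> ring
  have hfin := hεm (u i₀) (ε * u i₁) (by linarith [hu0.1]) (by nlinarith [hu0.2, hu1.1])
    (by nlinarith [hu0.1, hu1.2])
  rw [hεε] at hfin
  refine ⟨fun i => ?_, hfin.1, hfin.2, ?_, ?_⟩
  · have h1 := hu' i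
    have h2 := hcenb i
    have h3 : h i ≤ 1 := by
      by_cases hi0 : i = i₀
      · rw [hi0, hh0]; linarith
      · rw [hh1 i hi0]; norm_num
    rw [abs_le] at h1 h2 ⊢
    constructor <;> linarith [h1.1, h1.2, h2.1, h2.2]
  · nlinarith [hu0.1]
  · have hsum : ∑ i, d i * u i = (S + d k * δ) +
        ∑ i, d i * (u i - (cen i + if i = k then δ else 0)) := by
      simp only [mul_sub, mul_add, Finset.sum_sub_distrib, Finset.sum_add_distrib]
      simp [hS]
    have herr : |∑ i, d i * (u i - (cen i + if i = k then δ else 0))| ≤ h k * |d k| / 4 := by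
      refine (Finset.abs_sum_le_sum_abs _ _).trans ?_
      calc _ ≤ ∑ i : Fin n, h k * |d k| / (4 * n) := by
            refine Finset.sum_le_sum fun i _ => ?_
            rw [abs_mul]
            calc _ ≤ |d i| * (h i / (4 * n)) := mul_le_mul_of_nonneg_left (hu i) (abs_nonneg _)
              _ = h i * |d i| / (4 * n) := by ring
              _ ≤ _ := by
                exact div_le_div_of_nonneg_right (hk i (by simp)) (by positivity)
        _ = _ := by
            simp only [Finset.sum_const, Finset.card_univ, Fintype.card_fin, nsmul_eq_mul]
            field_simp
    rw [hsum]
    have h1 := abs_sub_abs_le_abs_add (S + d k * δ) (∑ i, d i * (u i - (cen i + if i = k then δ else 0)))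
    have h2 : β / (24000 * n) = β / (6000 * n) / 4 := by field_simp; norm_num
    rw [h2]
    linarith
/-- The length of the intersection of the intervals with endpoints `x, y` and `z, w`
(negative if they are disjoint). -/
def segOverlap (x y z w : ℝ) : ℝ := min (max x y) (max z w) - max (min x y) (min z w)

theorem le_segOverlap {a x y κ : ℝ} (h₁ : a / 4 ≤ x) (h₂ : x ≤ 3 * a / 4) (hκ : κ ≤ a / 4)
    (hxy : κ ≤ |y - x|) : κ ≤ segOverlap 0 a x y := by
  unfold segOverlap
  have ha : 0 ≤ a := by linarith
  rw [max_eq_right ha, min_eq_left ha]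
  rcases le_total x y with h | h
  · rw [max_eq_right h, min_eq_left h, max_eq_right (by linarith)]
    rw [abs_of_nonneg (by linarith)] at hxy
    have : x + κ ≤ min a y := le_min (by linarith) (by linarith)
    linarith
  · rw [max_eq_left h, min_eq_right h, min_eq_right (by linarith)]
    rw [abs_of_nonpos (by linarith)] at hxy
    have : max 0 y ≤ x - κ := max_le (by linarith) (by linarith)
    linarith

theorem continuous_segOverlap : Continuous fun x : ℝ × ℝ × ℝ × ℝ =>
    segOverlap x.1 x.2.1 x.2.2.1 x.2.2.2 := by
  unfold segOverlap
  fun_prop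

theorem segOverlap_add_mul {ρ : ℝ} (hρ : 0 ≤ ρ) (t x y z w : ℝ) :
    segOverlap (t + ρ * x) (t + ρ * y) (t + ρ * z) (t + ρ * w) = ρ * segOverlap x y z w := by
  have hmax : ∀ x y, max (t + ρ * x) (t + ρ * y) = t + ρ * max x y := fun x y => by
    rw [max_add_add_left, mul_max_of_nonneg _ _ hρ]
  have hmin : ∀ x y, min (t + ρ * x) (t + ρ * y) = t + ρ * min x y := fun x y => by
    rw [min_add_add_left, mul_min_of_nonneg _ _ hρ]
  unfold segOverlap
  rw [hmax, hmax, hmin, hmin, hmin, hmax]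
  ring

theorem volume_coordinate_box {n : ℕ} (b : OrthonormalBasis (Fin n) ℝ (EuclideanSpace ℝ (Fin n)))
    (z l : Fin n → ℝ) :
    MeasurableSet {u | ∀ i, |b.repr u i - z i| ≤ l i} ∧
    volume {u | ∀ i, |b.repr u i - z i| ≤ l i} = ∏ i, ENNReal.ofReal (2 * l i) := by
  have hset : MeasurableSet (Set.pi univ fun i => closedBall (z i) (l i)) :=
    MeasurableSet.univ_pi fun i => measurableSet_closedBall
  have heq : {u | ∀ i, |b.repr u i - z i| ≤ l i} =
      b.repr ⁻¹' (WithLp.ofLp ⁻¹' (Set.pi univ fun i => closedBall (z i) (l i))) := by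
    ext u
    simp [Real.dist_eq]
  have h1 := b.measurePreserving_repr
  have h2 := PiLp.volume_preserving_ofLp (Fin n)
  have hm := h2.measurable hset
  rw [heq]
  refine ⟨h1.measurable hm, ?_⟩
  rw [h1.measure_preimage hm.nullMeasurableSet, h2.measure_preimage hset.nullMeasurableSet,
    volume_pi_pi]
  simp

theorem exists_orthonormalBasis_pair {n : ℕ} {i₀ i₁ : Fin n} (hi : i₁ ≠ i₀)
    {x y : EuclideanSpace ℝ (Fin n)} (hx : ‖x‖ = 1) (hy : ‖y‖ = 1) (hxy : inner ℝ x y = 0) :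
    ∃ b : OrthonormalBasis (Fin n) ℝ (EuclideanSpace ℝ (Fin n)), b i₀ = x ∧ b i₁ = y := by
  classical
  let v : Fin n → EuclideanSpace ℝ (Fin n) := fun i => if i = i₀ then x else y
  have hv : Orthonormal ℝ (({i₀, i₁} : Set (Fin n)).domRestrict v) := by
    constructor
    · rintro ⟨i, hi'⟩
      simp only [domRestrict_apply, v]
      split_ifs <;> assumption
    · rintro ⟨i, rfl | rfl⟩ ⟨j, rfl | rfl⟩ hij
      · simp at hij
      · simp [v, hi, hxy]
      · simp [v, hi, real_inner_comm, hxy]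
      · simp at hij
  obtain ⟨b, hb⟩ := hv.exists_orthonormalBasis_extension_of_card_eq (by simp)
  exact ⟨b, by simpa [v] using hb i₀ (by simp), by simpa [v, hi] using hb i₁ (by simp)⟩

theorem exists_le_lintegral_segOverlap_inner {n : ℕ} (hn : 2 ≤ n) :
    ∃ c > 0, ∃ R > 0, ∀ s p q : EuclideanSpace ℝ (Fin n), 1 ≤ ‖s‖ → ‖s‖ ≤ 11 → ‖p‖ ≤ 7 →
      1 ≤ ‖q - p‖ →
      ENNReal.ofReal (c * infDist p {x | ∃ t : ℝ, x = t • s} ^ 2) ≤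
        ∫⁻ u in closedBall 0 R,
          ENNReal.ofReal (segOverlap 0 (inner ℝ u s) (inner ℝ u p) (inner ℝ u q)) := by
  have hn0 : (0 : ℝ) < n := by positivity
  set κ : ℝ := 1 / (24000 * n) with hκ
  refine ⟨2 * κ * (2 * ((1 / 512) / (4 * n))) ^ (n - 1) * κ, by positivity, 60 * n, by positivity,
    fun s p q hs hs' hp hpq => ?_⟩
  set c := 2 * κ * (2 * ((1 / 512) / (4 * (n : ℝ)))) ^ (n - 1) * κ with hc
  have hc0 : 0 ≤ c := by positivity
  have hs0 : ‖s‖ ≠ 0 := by linarith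
  obtain ⟨e, he⟩ : ∃ e, e = ‖s‖⁻¹ • s := ⟨_, rfl⟩
  have hse : s = ‖s‖ • e := by rw [he, smul_smul, mul_inv_cancel₀ hs0, one_smul]
  have hen : ‖e‖ = 1 := by rw [he, norm_smul, norm_inv, norm_norm, inv_mul_cancel₀ hs0]
  set p₀ : ℝ := inner ℝ e p with hp₀
  set p' := p - p₀ • e with hp'
  have hep' : inner ℝ e p' = (0 : ℝ) := by
    rw [hp', inner_sub_right, inner_smul_right, real_inner_self_eq_norm_sq, hen]
    simp [hp₀]
  have hdist : infDist p {x | ∃ t : ℝ, x = t • s} ≤ ‖p'‖ := by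
    have hmem : p₀ • e ∈ {x | ∃ t : ℝ, x = t • s} := ⟨p₀ * ‖s‖⁻¹, by rw [he, smul_smul]⟩
    exact (infDist_le_dist_of_mem hmem).trans_eq (dist_eq_norm _ _)
  set β := ‖p'‖ with hβ
  have hle : ENNReal.ofReal (c * infDist p {x | ∃ t : ℝ, x = t • s} ^ 2) ≤
      ENNReal.ofReal (c * β ^ 2) := by
    apply ENNReal.ofReal_le_ofReal
    apply mul_le_mul_of_nonneg_left _ hc0
    exact pow_le_pow_left₀ infDist_nonneg hdist 2
  refine hle.trans ?_
  rcases (norm_nonneg p').eq_or_lt with hβ0 | hβ0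
  · rw [← hβ] at hβ0
    simp [← hβ0]
  have hpp : ‖p‖ ^ 2 = p₀ ^ 2 + β ^ 2 := by
    have h1 : p = p₀ • e + p' := by rw [hp']; abel
    rw [h1, norm_add_sq_real, norm_smul, hen, inner_smul_left, hep']
    simp [hβ]
  have hp2 : ‖p‖ ^ 2 ≤ 7 ^ 2 := pow_le_pow_left₀ (norm_nonneg _) hp 2
  have hβ7 : β ≤ 7 := by nlinarith [sq_nonneg p₀]
  have hp7 : |p₀| ≤ 7 := by
    apply abs_le_of_sq_le_sq _ (by norm_num)
    nlinarith [sq_nonneg β]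
  let i₀ : Fin n := ⟨0, by omega⟩
  let i₁ : Fin n := ⟨1, by omega⟩
  have hi : i₁ ≠ i₀ := by simp [i₀, i₁]
  obtain ⟨b, hb0, hb1⟩ := exists_orthonormalBasis_pair hi (x := e) (y := β⁻¹ • p') hen
    (by rw [norm_smul, norm_inv, norm_norm, inv_mul_cancel₀ hβ0.ne'])
    (by rw [inner_smul_right, hep', mul_zero])
  have hpb : p = p₀ • b i₀ + β • b i₁ := by
    rw [hb0, hb1, smul_smul, mul_inv_cancel₀ hβ0.ne', one_smul, hp']; abel
  have hd : 1 ≤ ∑ i, (b.repr (q - p) i) ^ 2 := by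
    have h1 : ‖b.repr (q - p)‖ = ‖q - p‖ := b.repr.norm_map _
    have h2 := EuclideanSpace.norm_sq_eq (b.repr (q - p))
    simp only [Real.norm_eq_abs, sq_abs] at h2
    rw [← h2, h1]
    nlinarith
  obtain ⟨z, hz⟩ := exists_coordinate_box hi hβ0 hβ7 hp7 hs hs' hd
  set l : Fin n → ℝ := fun i => (if i = i₀ then β / 6000 else 1 / 512) / (4 * n) with hl
  obtain ⟨hUm, hUv⟩ := volume_coordinate_box b z l
  set U := {u | ∀ i, |b.repr u i - z i| ≤ l i} with hU
  have hUR : U ⊆ closedBall 0 (60 * n) := by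
    intro u hu
    have h1 := (hz (b.repr u) hu).1
    rw [mem_closedBall_zero_iff, ← b.repr.norm_map, EuclideanSpace.norm_eq]
    apply Real.sqrt_le_iff.2 ⟨by positivity, ?_⟩
    calc ∑ i, ‖b.repr u i‖ ^ 2 ≤ ∑ i : Fin n, (60 : ℝ) ^ 2 :=
          Finset.sum_le_sum fun i _ => pow_le_pow_left₀ (norm_nonneg _) (h1 i) 2
      _ = n * 60 ^ 2 := by simp
      _ ≤ _ := by
        have : (1 : ℝ) ≤ n := by exact_mod_cast (by omega : 1 ≤ n)
        nlinarith
  have hUo : ∀ u ∈ U, κ * β ≤ segOverlap 0 (inner ℝ u s) (inner ℝ u p) (inner ℝ u q) := by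
    intro u hu
    obtain ⟨-, h1, h2, h3, h4⟩ := hz (b.repr u) hu
    have hus : inner ℝ u s = ‖s‖ * b.repr u i₀ := by
      rw [b.repr_apply_apply, hb0, real_inner_comm u e, ← inner_smul_right, ← hse]
    have hup : inner ℝ u p = p₀ * b.repr u i₀ + β * b.repr u i₁ := by
      rw [b.repr_apply_apply, b.repr_apply_apply, real_inner_comm u, real_inner_comm u,
        ← inner_smul_right, ← inner_smul_right, ← inner_add_right, ← hpb]
    have huq : inner ℝ u q - inner ℝ u p = ∑ i, b.repr (q - p) i * b.repr u i := by
      rw [← inner_sub_right, ← b.repr.inner_map_map, PiLp.inner_apply]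
      simp
    have hκβ : κ * β = β / (24000 * n) := by rw [hκ]; ring
    have h5 : κ * β ≤ β / 60 := by
      rw [hκβ]
      apply div_le_div_of_nonneg_left hβ0.le (by norm_num)
      have : (1 : ℝ) ≤ n := by exact_mod_cast (by omega : 1 ≤ n)
      linarith
    apply le_segOverlap
    · rw [hus, hup]; exact h1
    · rw [hus, hup]; exact h2
    · rw [hus]; exact h5.trans h3
    · rw [huq, hκβ]; exact h4
  have hprod : ∏ i, ENNReal.ofReal (2 * l i) =
      ENNReal.ofReal (2 * κ * β * (2 * ((1 / 512) / (4 * (n : ℝ)))) ^ (n - 1)) := by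
    rw [← Finset.mul_prod_erase _ _ (Finset.mem_univ i₀)]
    have h1 : ∏ i ∈ Finset.univ.erase i₀, ENNReal.ofReal (2 * l i) =
        ∏ i ∈ Finset.univ.erase i₀, ENNReal.ofReal (2 * ((1 / 512) / (4 * (n : ℝ)))) := by
      refine Finset.prod_congr rfl fun i hi => ?_
      simp [hl, (Finset.mem_erase.1 hi).1]
    rw [h1, Finset.prod_const, Finset.card_erase_of_mem (Finset.mem_univ _), Finset.card_univ,
      Fintype.card_fin, ← ENNReal.ofReal_pow (by positivity), ← ENNReal.ofReal_mul]
    · congr 2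
      simp only [hl, if_true, hκ]
      field_simp
      ring
    · simp only [hl, if_true]; positivity
  calc ENNReal.ofReal (c * β ^ 2) = ENNReal.ofReal (κ * β) * volume U := by
        rw [hUv, hprod, ← ENNReal.ofReal_mul (by positivity), hc]
        congr 1; ring
    _ = ∫⁻ u in U, ENNReal.ofReal (κ * β) := (setLIntegral_const _ _).symm
    _ ≤ ∫⁻ u in U, ENNReal.ofReal (segOverlap 0 (inner ℝ u s) (inner ℝ u p) (inner ℝ u q)) :=
        setLIntegral_mono' hUm fun u hu => ENNReal.ofReal_le_ofReal (hUo u hu)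
    _ ≤ _ := lintegral_mono_set hUR

/-- Average over the normals `u` of the measure of the set of hyperplanes orthogonal to `u` which
separate both `r` from `s` and `p` from `q`. -/
theorem exists_le_lintegral_segOverlap {n : ℕ} (hn : 2 ≤ n) :
    ∃ c > 0, ∃ R > 0, ∀ (ρ : ℝ) (r s p q : EuclideanSpace ℝ (Fin n)), 0 < ρ →
      ρ ≤ ‖s - r‖ → ‖s - r‖ ≤ 11 * ρ → ‖p - r‖ ≤ 7 * ρ → ρ ≤ ‖q - p‖ →
      ENNReal.ofReal (c * (infDist p {x | ∃ t : ℝ, x = r + t • (s - r)} / ρ) ^ 2 * ρ) ≤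
        ∫⁻ u in closedBall 0 R, ENNReal.ofReal
          (segOverlap (inner ℝ u r) (inner ℝ u s) (inner ℝ u p) (inner ℝ u q)) := by
  obtain ⟨c, hc, R, hR, h⟩ := exists_le_lintegral_segOverlap_inner hn
  refine ⟨c, hc, R, hR, fun ρ r s p q hρ h1 h2 h3 h4 => ?_⟩
  have hnorm : ∀ x : EuclideanSpace ℝ (Fin n), ‖ρ⁻¹ • x‖ = ‖x‖ / ρ := by
    intro x
    rw [norm_smul, norm_inv, Real.norm_of_nonneg hρ.le]; ring
  have key := h (ρ⁻¹ • (s - r)) (ρ⁻¹ • (p - r)) (ρ⁻¹ • (q - r))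
    (by rw [hnorm, le_div_iff₀ hρ]; linarith) (by rw [hnorm, div_le_iff₀ hρ]; linarith)
    (by rw [hnorm, div_le_iff₀ hρ]; linarith)
    (by rw [← smul_sub, sub_sub_sub_cancel_right, hnorm, le_div_iff₀ hρ]; linarith)
  have hdist : infDist p {x | ∃ t : ℝ, x = r + t • (s - r)} / ρ ≤
      infDist (ρ⁻¹ • (p - r)) {x | ∃ t : ℝ, x = t • ρ⁻¹ • (s - r)} := by
    have hne : {x | ∃ t : ℝ, x = t • ρ⁻¹ • (s - r)}.Nonempty := ⟨0, 0, by simp⟩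
    refine (le_infDist hne).2 ?_
    rintro _ ⟨t, rfl⟩
    rw [div_le_iff₀ hρ]
    have hmem : r + t • (s - r) ∈ {x | ∃ t : ℝ, x = r + t • (s - r)} := ⟨t, rfl⟩
    refine (infDist_le_dist_of_mem hmem).trans_eq ?_
    rw [dist_eq_norm, dist_eq_norm, smul_comm t, ← smul_sub, hnorm, div_mul_cancel₀ _ hρ.ne']
    congr 1; abel
  have hseg : ∀ u : EuclideanSpace ℝ (Fin n),
      segOverlap (inner ℝ u r) (inner ℝ u s) (inner ℝ u p) (inner ℝ u q) =
      ρ * segOverlap 0 (inner ℝ u (ρ⁻¹ • (s - r))) (inner ℝ u (ρ⁻¹ • (p - r)))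
        (inner ℝ u (ρ⁻¹ • (q - r))) := by
    intro u
    rw [← segOverlap_add_mul hρ.le (inner ℝ u r)]
    have : ∀ x : EuclideanSpace ℝ (Fin n),
        inner ℝ u r + ρ * inner ℝ u (ρ⁻¹ • (x - r)) = inner ℝ u x := by
      intro x
      rw [inner_smul_right, inner_sub_right, ← mul_assoc, mul_inv_cancel₀ hρ.ne']; ring
    rw [this, this, this]
    simp
  simp_rw [hseg, ENNReal.ofReal_mul hρ.le]
  rw [lintegral_const_mul' _ _ ENNReal.ofReal_ne_top]
  refine le_trans ?_ (mul_le_mul_right key _)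
  rw [← ENNReal.ofReal_mul hρ.le]
  apply ENNReal.ofReal_le_ofReal
  rw [mul_comm ρ]
  gcongr
  exact div_nonneg infDist_nonneg hρ.le

theorem abs_apply_sub_le_dist {n : ℕ} (x y : EuclideanSpace ℝ (Fin n)) (i : Fin n) :
    |x i - y i| ≤ dist x y := by
  rw [dist_eq_norm, ← Real.norm_eq_abs]
  exact PiLp.norm_apply_le (x - y) i

/-- Boundedly many dyadic cubes of a given generation meet a ball of comparable radius. -/
theorem exists_finset_dyadicCube (n : ℕ) (R : ℝ) :
    ∃ N : ℕ, ∀ (k : ℤ) (w : EuclideanSpace ℝ (Fin n)), ∃ Z : Finset (Fin n → ℤ), Z.card ≤ N ∧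
      ∀ z, ∀ x ∈ dyadicCube n k z, dist x w ≤ R * 2 ^ (-k) → z ∈ Z := by
  set B : ℕ := ⌈R⌉₊ with hB
  refine ⟨(2 * B + 3) ^ n, fun k w => ⟨Fintype.piFinset fun i =>
    Finset.Icc (⌊w i * 2 ^ k⌋ - B - 1) (⌊w i * 2 ^ k⌋ + B + 1), ?_, fun z x hx hd => ?_⟩⟩
  · rw [Fintype.card_piFinset]
    refine (Finset.prod_le_pow_card _ _ (2 * B + 3) fun i _ => ?_).trans (by simp)
    rw [Int.card_Icc]
    omega
  · rw [Fintype.mem_piFinset]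
    intro i
    have h2 : (0 : ℝ) < 2 ^ (-k) := by positivity
    have h2' : (2 : ℝ) ^ (-k) * 2 ^ k = 1 := by rw [← zpow_add₀ (by norm_num)]; simp
    have hk : (0 : ℝ) < 2 ^ k := by positivity
    obtain ⟨h3, h4⟩ := abs_le.1 ((abs_apply_sub_le_dist x w i).trans hd)
    obtain ⟨h5, h6⟩ := hx i
    have hBR : R ≤ B := Nat.le_ceil R
    have h7 : (z i : ℝ) ≤ w i * 2 ^ k + R := by
      have := mul_le_mul_of_nonneg_right (show (z i : ℝ) * 2 ^ (-k) ≤ w i + R * 2 ^ (-k) by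
        linarith) hk.le
      rw [add_mul, mul_assoc, mul_assoc, h2'] at this
      linarith
    have h8 : w i * 2 ^ k - R - 1 ≤ (z i : ℝ) := by
      have := mul_le_mul_of_nonneg_right (show w i ≤ ((z i : ℝ) + 1) * 2 ^ (-k) + R * 2 ^ (-k) by
        linarith) hk.le
      rw [add_mul, mul_assoc, mul_assoc, h2'] at this
      linarith
    rw [Finset.mem_Icc]
    have h9 := Int.floor_le (w i * 2 ^ k)
    have h10 := Int.lt_floor_add_one (w i * 2 ^ k)
    constructor
    · have : ((⌊w i * 2 ^ k⌋ - B - 1 : ℤ) : ℝ) ≤ z i := by push_cast; linarith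
      exact_mod_cast this
    · have : ((z i : ℤ) : ℝ) < (⌊w i * 2 ^ k⌋ + B + 1 + 1 : ℤ) := by push_cast; linarith
      have : z i < ⌊w i * 2 ^ k⌋ + B + 1 + 1 := by exact_mod_cast this
      omega

theorem exists_net_extension {α : Type*} [MetricSpace α] (X S : Finset α) {δ : ℝ} (hδ : 0 ≤ δ)
    (hSX : S ⊆ X) (hS : ∀ x ∈ S, ∀ y ∈ S, x ≠ y → δ < dist x y) :
    ∃ T, S ⊆ T ∧ (T ⊆ X ∧ ∀ x ∈ T, ∀ y ∈ T, x ≠ y → δ < dist x y) ∧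
      ∀ x ∈ X, ∃ y ∈ T, dist x y ≤ δ := by
  classical
  let A := X.powerset.filter fun T => ∀ x ∈ T, ∀ y ∈ T, x ≠ y → δ < dist x y
  have hSA : S ∈ A := by simp [A, hSX]; exact hS
  obtain ⟨T, hST, hT⟩ := A.exists_le_maximal hSA
  obtain ⟨hTX, hTs⟩ : T ⊆ X ∧ ∀ x ∈ T, ∀ y ∈ T, x ≠ y → δ < dist x y := by
    have := hT.prop
    simpa only [A, Finset.mem_filter, Finset.mem_powerset] using this
  refine ⟨T, hST, ⟨hTX, hTs⟩, fun x hx => ?_⟩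
  by_contra! h
  have hins : insert x T ∈ A := by
    simp only [A, Finset.mem_filter, Finset.mem_powerset]
    refine ⟨Finset.insert_subset hx hTX, ?_⟩
    intro a ha b hb hab
    rcases Finset.mem_insert.1 ha with rfl | ha' <;> rcases Finset.mem_insert.1 hb with rfl | hb'
    · exact absurd rfl hab
    · exact h b hb'
    · rw [dist_comm]; exact h a ha'
    · exact hTs a ha' b hb' hab
  have hxT : x ∈ T := hT.le_of_ge hins (Finset.subset_insert x T) (Finset.mem_insert_self x T)
  have := h x hxT
  rw [dist_self] at this
  linarith

/-- Nested maximal separated subsets of a finite set. -/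
theorem exists_monotone_nets {α : Type*} [MetricSpace α] (X : Finset α) {δ : ℕ → ℝ}
    (hδ : ∀ j, 0 ≤ δ j) (hanti : Antitone δ) :
    ∃ N : ℕ → Finset α, Monotone N ∧ ∀ j, (N j ⊆ X ∧
      ∀ x ∈ N j, ∀ y ∈ N j, x ≠ y → δ j < dist x y) ∧ ∀ x ∈ X, ∃ y ∈ N j, dist x y ≤ δ j := by
  have key : ∀ (j : ℕ) (S : Finset α), (S ⊆ X ∧ ∀ x ∈ S, ∀ y ∈ S, x ≠ y → δ j < dist x y) →
      ∃ T, S ⊆ T ∧ (T ⊆ X ∧ ∀ x ∈ T, ∀ y ∈ T, x ≠ y → δ j < dist x y) ∧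
      ∀ x ∈ X, ∃ y ∈ T, dist x y ≤ δ j := fun j S h => exists_net_extension X S (hδ j) h.1 h.2
  choose! step h1 h2 h3 using key
  let N : ℕ → Finset α := fun j => Nat.rec (step 0 ∅) (fun i S => step (i + 1) S) j
  have hN : ∀ j, N j ⊆ X ∧ ∀ x ∈ N j, ∀ y ∈ N j, x ≠ y → δ j < dist x y := by
    intro j
    induction j with
    | zero => exact h2 0 ∅ (by simp)
    | succ i ih => exact h2 (i + 1) (N i) ⟨ih.1, fun x hx y hy hxy =>
        (hanti (Nat.le_succ i)).trans_lt (ih.2 x hx y hy hxy)⟩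
  have hN' : ∀ i, N i ⊆ X ∧ ∀ x ∈ N i, ∀ y ∈ N i, x ≠ y → δ (i + 1) < dist x y := fun i =>
    ⟨(hN i).1, fun x hx y hy hxy => (hanti (Nat.le_succ i)).trans_lt ((hN i).2 x hx y hy hxy)⟩
  refine ⟨N, monotone_nat_of_le_succ fun i => h1 (i + 1) (N i) (hN' i), fun j => ⟨hN j, ?_⟩⟩
  cases j with
  | zero => exact h3 0 ∅ (by simp)
  | succ i => exact h3 (i + 1) (N i) (hN' i)

/-- A finite set `X` can contain two points at mutual distance comparable to the side length near
at most `M * X.card` dyadic cubes. -/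
theorem exists_card_dyadicCube_le (n : ℕ) {C : ℝ} (hC : 0 < C) :
    ∃ M : ℕ, ∀ (X : Finset (EuclideanSpace ℝ (Fin n))) (F : Finset (ℕ × (Fin n → ℤ))),
      (∀ Q ∈ F, ∃ x ∈ dyadicCube n Q.1 Q.2, ∃ y ∈ X, ∃ y' ∈ X,
        dist y x ≤ 6 * (C * 2 ^ (-(Q.1 : ℤ))) ∧ dist y' x ≤ 6 * (C * 2 ^ (-(Q.1 : ℤ))) ∧
        C * 2 ^ (-(Q.1 : ℤ)) ≤ dist y y') → F.card ≤ M * X.card := by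
  classical
  obtain ⟨M, hM⟩ := exists_finset_dyadicCube n (7 * C)
  refine ⟨7 * M, fun X F hF => ?_⟩
  have hpow : ∀ j : ℕ, (2 : ℝ) ^ (-(j : ℤ)) = (1 / 2) ^ j := fun j => by simp
  let δ : ℕ → ℝ := fun j => 32 * (C * (1 / 2) ^ j)
  obtain ⟨N, hmono, hN⟩ := exists_monotone_nets X (δ := δ) (fun j => by positivity) (by
    intro i j hij
    have := pow_le_pow_of_le_one (by norm_num : (0 : ℝ) ≤ 1 / 2) (by norm_num) hij
    simp only [δ]; gcongr)
  let rank : EuclideanSpace ℝ (Fin n) → ℕ := fun x => sInf {j | x ∈ N j}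
  have hch : ∀ Q ∈ F, ∃ w ∈ X, (Q.1 < rank w ∧ rank w ≤ Q.1 + 7) ∧
      ∃ x ∈ dyadicCube n Q.1 Q.2, dist x w ≤ (7 * C) * 2 ^ (-(Q.1 : ℤ)) := by
    rintro ⟨k, z⟩ hQ
    obtain ⟨x, hx, y, hy, y', hy', h1, h2, h3⟩ := hF _ hQ
    simp only at hx h1 h2 h3 ⊢
    set ρ := C * (2 : ℝ) ^ (-(k : ℤ)) with hρ
    have hρ0 : 0 < ρ := by positivity
    have hδk : δ k = 32 * ρ := by simp only [δ, hρ, hpow]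
    have hδk7 : δ (k + 7) = ρ / 4 := by simp only [δ, hρ, hpow, pow_add]; ring
    have hrank : ∀ w, w ∈ N (k + 7) → w ∉ N k → k < rank w ∧ rank w ≤ k + 7 := by
      intro w hw hw'
      have hle : rank w ≤ k + 7 := Nat.sInf_le hw
      have hmem : w ∈ N (rank w) := Nat.sInf_mem (s := {j | w ∈ N j}) ⟨_, hw⟩
      exact ⟨by_contra fun h => hw' (hmono (not_lt.1 h) hmem), hle⟩
    obtain ⟨w, hw, hwy⟩ := (hN (k + 7)).2 y hy
    obtain ⟨w', hw', hwy'⟩ := (hN (k + 7)).2 y' hy'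
    rw [hδk7] at hwy hwy'
    have hne : w ≠ w' := by
      rintro rfl
      have := dist_triangle_right y y' w
      linarith
    have hxw : dist x w ≤ 7 * C * 2 ^ (-(k : ℤ)) := by
      have := dist_triangle_left x w y
      rw [mul_assoc]; linarith
    have hxw' : dist x w' ≤ 7 * C * 2 ^ (-(k : ℤ)) := by
      have := dist_triangle_left x w' y'
      rw [mul_assoc]; linarith
    by_cases hk : w ∈ N k
    · refine ⟨w', (hN _).1.1 hw', hrank w' hw' fun hk' => ?_, x, hx, hxw'⟩
      have h4 := (hN k).1.2 w hk w' hk' hne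
      have := dist_triangle_left w w' x
      rw [mul_assoc] at hxw hxw'
      linarith
    · exact ⟨w, (hN _).1.1 hw, hrank w hw hk, x, hx, hxw⟩
  choose! w hwX hwr hwx using hch
  refine Finset.card_le_mul_card_image_of_maps_to hwX (7 * M) fun v _ => ?_
  choose Z hZ hZ' using fun k : ℕ => hM k v
  have hsub : (F.filter fun Q => w Q = v) ⊆
      (Finset.Ico (rank v - 7) (rank v)).biUnion fun k => (Z k).image fun z => (k, z) := by
    intro Q hQ
    obtain ⟨hQF, rfl⟩ := Finset.mem_filter.1 hQ
    obtain ⟨x, hx, hxd⟩ := hwx Q hQF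
    have := hwr Q hQF
    simp only [Finset.mem_biUnion, Finset.mem_Ico, Finset.mem_image]
    exact ⟨Q.1, by omega, Q.2, hZ' _ _ x hx hxd, rfl⟩
  refine (Finset.card_le_card hsub).trans ((Finset.card_biUnion_le_card_mul _ _ M fun k _ =>
    Finset.card_image_le.trans (hZ k)).trans ?_)
  gcongr
  rw [Nat.card_Ico]
  omega

/-- A continuous curve passing through `x` and leaving the ball of radius `6 * ρ` yields a line `rs`
and a chord `pq` of the curve such that `p` is the point of the curve near `x` farthest from `rs`,
and each hyperplane separating both `r` from `s` and `p` from `q` meets the curve at two distant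
points near `x`. -/
theorem exists_chords {n : ℕ} {f : ℝ → EuclideanSpace ℝ (Fin n)} (hf : Continuous f) {a b : ℝ}
    {ρ : ℝ} (hρ : 0 < ρ) {x y : EuclideanSpace ℝ (Fin n)} (hx : x ∈ f '' Icc a b)
    (hy : y ∈ f '' Icc a b) (hxy : 6 * ρ ≤ dist y x) :
    ∃ r s p q : EuclideanSpace ℝ (Fin n), ρ ≤ ‖s - r‖ ∧ ‖s - r‖ ≤ 11 * ρ ∧ ‖p - r‖ ≤ 7 * ρ ∧
      ρ ≤ ‖q - p‖ ∧
      (∀ p' ∈ f '' Icc a b, dist p' x ≤ ρ → infDist p' {v | ∃ t : ℝ, v = r + t • (s - r)} ≤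
        infDist p {v | ∃ t : ℝ, v = r + t • (s - r)}) ∧
      ∀ (u : EuclideanSpace ℝ (Fin n)) (c : ℝ),
        max (min (inner ℝ u r) (inner ℝ u s)) (min (inner ℝ u p) (inner ℝ u q)) < c →
        c < min (max (inner ℝ u r) (inner ℝ u s)) (max (inner ℝ u p) (inner ℝ u q)) →
        ∃ t ∈ Icc a b, ∃ t' ∈ Icc a b, inner ℝ u (f t) = c ∧ inner ℝ u (f t') = c ∧
          dist (f t) x ≤ 6 * ρ ∧ dist (f t') x ≤ 6 * ρ ∧ ρ ≤ dist (f t) (f t') := by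
  obtain ⟨t₀, ht₀, rfl⟩ := hx
  obtain ⟨t₁, ht₁, rfl⟩ := hy
  set x := f t₀ with hx
  have hIcc : ∀ {t t'}, t ∈ Icc a b → t' ∈ Icc a b → uIcc t t' ⊆ Icc a b :=
    fun h h' => ordConnected_Icc.uIcc_subset h h'
  obtain ⟨τ, τ', hτsub, hτ, hτ', harc⟩ := exists_uIcc_crossing (g := fun t => dist (f t) x)
    (hf.dist continuous_const) (t₀ := t₀) (t₁ := t₁) (α := 5 * ρ) (β := 6 * ρ) (by linarith)
    (by simp only [hx, dist_self]; linarith) hxy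
  set L := {v | ∃ t : ℝ, v = f τ + t • (f τ' - f τ)} with hL
  have hcomp : IsCompact (f '' Icc a b ∩ closedBall x ρ) :=
    (isCompact_Icc.image hf).inter_right isClosed_closedBall
  obtain ⟨p, ⟨⟨tp, htp, rfl⟩, hpx⟩, hpmax⟩ := hcomp.exists_isMaxOn (f := fun v => infDist v L)
    ⟨x, ⟨t₀, ht₀, rfl⟩, mem_closedBall_self hρ.le⟩ (continuous_infDist_pt L).continuousOn
  rw [mem_closedBall] at hpx
  have h1 : ρ ≤ dist (f t₁) (f tp) := by
    have := dist_triangle (f t₁) (f tp) x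
    linarith
  obtain ⟨σ, σ', hσsub, hσ, hσ', hσarc⟩ := exists_uIcc_crossing (g := fun t => dist (f t) (f tp))
    (hf.dist continuous_const) (t₀ := tp) (t₁ := t₁) (α := 0) (β := ρ) hρ.le
    (by simp) h1
  rw [dist_eq_zero] at hσ
  refine ⟨f τ, f τ', f tp, f σ', ?_, ?_, ?_, ?_, ?_, ?_⟩
  · rw [← dist_eq_norm]
    have := dist_triangle (f τ') (f τ) x
    linarith
  · rw [← dist_eq_norm]
    have := dist_triangle_right (f τ') (f τ) x
    linarith
  · rw [← dist_eq_norm]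
    have := dist_triangle_right (f tp) (f τ) x
    linarith
  · rw [← dist_eq_norm]; exact hσ'.ge
  · exact fun p' hp' hp'x => hpmax ⟨hp', hp'x⟩
  · intro u c hc hc'
    rw [max_lt_iff] at hc
    rw [lt_min_iff] at hc'
    have hcont : Continuous fun t => (inner ℝ u (f t) : ℝ) := continuous_const.inner hf
    have ivt : ∀ v w : ℝ, min (inner ℝ u (f v)) (inner ℝ u (f w)) < c →
        c < max (inner ℝ u (f v)) (inner ℝ u (f w)) → ∃ t ∈ uIcc v w, inner ℝ u (f t) = c := by
      intro v w h h'
      obtain ⟨t, ht, h⟩ := intermediate_value_uIcc (a := v) (b := w) hcont.continuousOn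
        (show c ∈ uIcc _ _ from ⟨h.le, h'.le⟩)
      exact ⟨t, ht, h⟩
    obtain ⟨t', ht', ht'c⟩ := ivt τ τ' hc.1 hc'.1
    obtain ⟨t, ht, htc⟩ := ivt σ σ' (by rw [hσ]; exact hc.2) (by rw [hσ]; exact hc'.2)
    have h2 := harc t' ht'
    have h3 := hσarc t ht
    have h4 := dist_triangle (f t) (f tp) x
    have h5 := dist_triangle_left (f t') x (f t)
    refine ⟨t, hIcc htp ht₁ (hσsub ht), t', hIcc ht₀ ht₁ (hτsub ht'), htc, ht'c, by linarith, h2.2,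
      by linarith⟩

/-- The multiscale estimate at a fixed direction `u`. -/
theorem sum_segOverlap_le {n : ℕ} {f : ℝ → EuclideanSpace ℝ (Fin n)} {K : ℝ≥0}
    (hf : LipschitzWith K f) {a b : ℝ} (hab : a < b) {C : ℝ} {M : ℕ}
    (hM : ∀ (X : Finset (EuclideanSpace ℝ (Fin n))) (F : Finset (ℕ × (Fin n → ℤ))),
      (∀ Q ∈ F, ∃ x ∈ dyadicCube n Q.1 Q.2, ∃ y ∈ X, ∃ y' ∈ X,
        dist y x ≤ 6 * (C * 2 ^ (-(Q.1 : ℤ))) ∧ dist y' x ≤ 6 * (C * 2 ^ (-(Q.1 : ℤ))) ∧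
        C * 2 ^ (-(Q.1 : ℤ)) ≤ dist y y') → F.card ≤ M * X.card)
    (F : Finset (ℕ × (Fin n → ℤ)))
    (x r s p q : ℕ × (Fin n → ℤ) → EuclideanSpace ℝ (Fin n))
    (hxQ : ∀ Q ∈ F, x Q ∈ dyadicCube n Q.1 Q.2)
    (u : EuclideanSpace ℝ (Fin n))
    (h : ∀ Q ∈ F, ∀ c : ℝ,
        max (min (inner ℝ u (r Q)) (inner ℝ u (s Q)))
          (min (inner ℝ u (p Q)) (inner ℝ u (q Q))) < c →
        c < min (max (inner ℝ u (r Q)) (inner ℝ u (s Q)))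
          (max (inner ℝ u (p Q)) (inner ℝ u (q Q))) →
        ∃ t ∈ Icc a b, ∃ t' ∈ Icc a b, inner ℝ u (f t) = c ∧ inner ℝ u (f t') = c ∧
          dist (f t) (x Q) ≤ 6 * (C * 2 ^ (-(Q.1 : ℤ))) ∧
          dist (f t') (x Q) ≤ 6 * (C * 2 ^ (-(Q.1 : ℤ))) ∧
          C * 2 ^ (-(Q.1 : ℤ)) ≤ dist (f t) (f t')) :
    ∑ Q ∈ F, ENNReal.ofReal (segOverlap (inner ℝ u (r Q)) (inner ℝ u (s Q)) (inner ℝ u (p Q))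
      (inner ℝ u (q Q))) ≤ M * ENNReal.ofReal (‖u‖ * K * (b - a)) := by
  classical
  set g : ℝ → ℝ := fun t => inner ℝ u (f t) with hg
  have hgL : LipschitzWith (‖u‖₊ * K) g := by
    apply LipschitzWith.of_dist_le_mul
    intro t t'
    rw [Real.dist_eq, hg]
    simp only
    rw [← inner_sub_right]
    refine (abs_real_inner_le_norm _ _).trans ?_
    rw [← dist_eq_norm]
    have := mul_le_mul_of_nonneg_left (hf.dist_le_mul t t') (norm_nonneg u)
    push_cast
    rw [mul_assoc]; exact this
  let I : ℕ × (Fin n → ℤ) → Set ℝ := fun Q =>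
    Ioo (max (min (inner ℝ u (r Q)) (inner ℝ u (s Q))) (min (inner ℝ u (p Q)) (inner ℝ u (q Q))))
      (min (max (inner ℝ u (r Q)) (inner ℝ u (s Q))) (max (inner ℝ u (p Q)) (inner ℝ u (q Q))))
  have hpt : ∀ c : ℝ, ∑ Q ∈ F, (I Q).indicator (1 : ℝ → ℝ≥0∞) c ≤
      M * liminf (fun m => partitionCount g a b m c) atTop := by
    intro c
    let G := F.filter fun Q => c ∈ I Q
    have hG : ∑ Q ∈ F, (I Q).indicator (1 : ℝ → ℝ≥0∞) c = (G.card : ℝ≥0∞) := by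
      rw [Finset.card_filter, Nat.cast_sum]
      refine Finset.sum_congr rfl fun Q _ => ?_
      by_cases hc : c ∈ I Q <;> simp [hc]
    have hch : ∀ Q ∈ G, _ := fun Q hQ => h Q (Finset.mem_filter.1 hQ).1 c
      (Finset.mem_filter.1 hQ).2.1 (Finset.mem_filter.1 hQ).2.2
    choose! t ht t' ht' htc ht'c hd hd' hdd using hch
    let T := G.image t ∪ G.image t'
    have hT : ∀ τ ∈ T, τ ∈ Icc a b ∧ g τ = c := by
      intro τ hτ
      rcases Finset.mem_union.1 hτ with hτ | hτ
      · obtain ⟨Q, hQ, rfl⟩ := Finset.mem_image.1 hτ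
        exact ⟨ht Q hQ, htc Q hQ⟩
      · obtain ⟨Q, hQ, rfl⟩ := Finset.mem_image.1 hτ
        exact ⟨ht' Q hQ, ht'c Q hQ⟩
    have hcard : G.card ≤ M * T.card := by
      refine (hM (T.image f) G fun Q hQ => ⟨x Q, hxQ Q (Finset.mem_filter.1 hQ).1, f (t Q), ?_,
        f (t' Q), ?_, hd Q hQ, hd' Q hQ, hdd Q hQ⟩).trans
        (Nat.mul_le_mul_left _ Finset.card_image_le)
      · exact Finset.mem_image_of_mem _ (Finset.mem_union_left _ (Finset.mem_image_of_mem _ hQ))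
      · exact Finset.mem_image_of_mem _ (Finset.mem_union_right _ (Finset.mem_image_of_mem _ hQ))
    rw [hG]
    calc (G.card : ℝ≥0∞) ≤ M * T.card := by exact_mod_cast hcard
      _ ≤ _ := by
        gcongr
        exact le_liminf_of_le (by isBoundedDefault) (eventually_card_le_partitionCount hab T hT)
  have hI : ∀ Q, ENNReal.ofReal (segOverlap (inner ℝ u (r Q)) (inner ℝ u (s Q))
      (inner ℝ u (p Q)) (inner ℝ u (q Q))) = ∫⁻ c, (I Q).indicator (1 : ℝ → ℝ≥0∞) c := by
    intro Q
    rw [lintegral_indicator_one measurableSet_Ioo, Real.volume_Ioo]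
    rfl
  calc _ = ∫⁻ c, ∑ Q ∈ F, (I Q).indicator (1 : ℝ → ℝ≥0∞) c := by
        rw [lintegral_finsetSum _ fun Q _ => measurable_one.indicator measurableSet_Ioo]
        exact Finset.sum_congr rfl fun Q _ => hI Q
    _ ≤ ∫⁻ c, M * liminf (fun m => partitionCount g a b m c) atTop := lintegral_mono hpt
    _ = M * ∫⁻ c, liminf (fun m => partitionCount g a b m c) atTop :=
        lintegral_const_mul' _ _ (ENNReal.natCast_ne_top M)
    _ ≤ _ := by
        gcongr
        refine (lintegral_liminf_le fun m => measurable_partitionCount hgL.continuous a b m).trans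
          (liminf_le_of_le (by isBoundedDefault) fun A hA => ?_)
        obtain ⟨m, hm⟩ := hA.exists
        refine hm.trans ((lintegral_partitionCount_le hgL a b m).trans_eq ?_)
        simp

/-- The analyst's travelling salesman estimate for a Lipschitz curve. -/
theorem exists_lines_of_lipschitz {n : ℕ} (hn : 2 ≤ n) {f : ℝ → EuclideanSpace ℝ (Fin n)} {K : ℝ≥0}
    (hf : LipschitzWith K f) {a b : ℝ} (hab : a < b) {C : ℝ} (hC : 0 < C)
    (S : Set (ℕ × (Fin n → ℤ))) (x : ℕ × (Fin n → ℤ) → EuclideanSpace ℝ (Fin n))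
    (hxQ : ∀ Q ∈ S, x Q ∈ dyadicCube n Q.1 Q.2) (hx : ∀ Q ∈ S, x Q ∈ f '' Icc a b)
    (hfar : ∀ Q ∈ S, ∃ y ∈ f '' Icc a b, 6 * (C * 2 ^ (-(Q.1 : ℤ))) ≤ dist y (x Q)) :
    ∃ (L : ℕ × (Fin n → ℤ) → Set (EuclideanSpace ℝ (Fin n))) (w : ℕ × (Fin n → ℤ) → ℝ),
      (∀ Q ∈ S, IsLine (L Q) ∧ ∀ p ∈ f '' Icc a b,
        dist p (x Q) ≤ C * 2 ^ (-(Q.1 : ℤ)) → infDist p (L Q) ≤ w Q * (C * 2 ^ (-(Q.1 : ℤ)))) ∧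
      ∃ A : ℝ≥0∞, A ≠ ⊤ ∧ ∀ F : Finset (ℕ × (Fin n → ℤ)), ↑F ⊆ S →
        ∑ Q ∈ F, ENNReal.ofReal (w Q ^ 2 * (C * 2 ^ (-(Q.1 : ℤ)))) ≤ A := by
  obtain ⟨c, hc, R, hR, hseg⟩ := exists_le_lintegral_segOverlap hn
  obtain ⟨M, hM⟩ := exists_card_dyadicCube_le n hC
  have hρ : ∀ Q : ℕ × (Fin n → ℤ), 0 < C * (2 : ℝ) ^ (-(Q.1 : ℤ)) := fun Q => by positivity
  have hch : ∀ Q ∈ S, _ := fun Q hQ => exists_chords hf.continuous (hρ Q) (hx Q hQ)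
    (hfar Q hQ).choose_spec.1 (hfar Q hQ).choose_spec.2
  choose! r s p q h1 h2 h3 h4 h5 h6 using hch
  let L : ℕ × (Fin n → ℤ) → Set (EuclideanSpace ℝ (Fin n)) :=
    fun Q => {v | ∃ t : ℝ, v = r Q + t • (s Q - r Q)}
  refine ⟨L, fun Q => infDist (p Q) (L Q) / (C * 2 ^ (-(Q.1 : ℤ))), fun Q hQ => ⟨⟨r Q, s Q - r Q,
    norm_pos_iff.1 ((hρ Q).trans_le (h1 Q hQ)), rfl⟩,
    fun p' hp' hd => ?_⟩, (ENNReal.ofReal c)⁻¹ * ∫⁻ _ in closedBall (0 : EuclideanSpace ℝ (Fin n)) R,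
      M * ENNReal.ofReal (R * K * (b - a)), ?_, fun F hF => ?_⟩
  · rw [div_mul_cancel₀ _ (hρ Q).ne']
    exact h5 Q hQ p' hp' hd
  · rw [setLIntegral_const]
    refine ENNReal.mul_ne_top (by simpa using hc) (ENNReal.mul_ne_top (ENNReal.mul_ne_top
      (ENNReal.natCast_ne_top M) ENNReal.ofReal_ne_top) measure_closedBall_lt_top.ne)
  · have hmeas : ∀ Q, Measurable fun u : EuclideanSpace ℝ (Fin n) => ENNReal.ofReal
        (segOverlap (inner ℝ u (r Q)) (inner ℝ u (s Q)) (inner ℝ u (p Q)) (inner ℝ u (q Q))) := by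
      intro Q
      have hi : ∀ v : EuclideanSpace ℝ (Fin n), Continuous fun u => (inner ℝ u v : ℝ) :=
        fun v => continuous_id.inner continuous_const
      exact (continuous_segOverlap.comp ((hi (r Q)).prodMk ((hi (s Q)).prodMk
        ((hi (p Q)).prodMk (hi (q Q)))))).measurable.ennreal_ofReal
    calc _ ≤ ∑ Q ∈ F, (ENNReal.ofReal c)⁻¹ * ∫⁻ u in closedBall 0 R, ENNReal.ofReal (segOverlap
          (inner ℝ u (r Q)) (inner ℝ u (s Q)) (inner ℝ u (p Q)) (inner ℝ u (q Q))) := by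
          refine Finset.sum_le_sum fun Q hQ => ?_
          have hQ' := hF hQ
          have := hseg _ _ _ _ _ (hρ Q) (h1 Q hQ') (h2 Q hQ') (h3 Q hQ') (h4 Q hQ')
          rw [mul_assoc, ENNReal.ofReal_mul hc.le] at this
          exact (ENNReal.mul_le_iff_le_inv (by simpa using hc) ENNReal.ofReal_ne_top).1 this
      _ = (ENNReal.ofReal c)⁻¹ * ∫⁻ u in closedBall 0 R, ∑ Q ∈ F, ENNReal.ofReal (segOverlap
          (inner ℝ u (r Q)) (inner ℝ u (s Q)) (inner ℝ u (p Q)) (inner ℝ u (q Q))) := by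
          rw [← Finset.mul_sum, lintegral_finsetSum _ fun Q _ => hmeas Q]
      _ ≤ _ := by
          refine mul_le_mul_right ?_ _
          refine setLIntegral_mono' measurableSet_closedBall fun u hu => ?_
          refine (sum_segOverlap_le hf hab hM F x r s p q (fun Q hQ => hxQ Q (hF hQ)) u
            fun Q hQ => h6 Q (hF hQ) u).trans ?_
          rw [mem_closedBall_zero_iff] at hu
          have : 0 ≤ b - a := by linarith
          gcongr

/-- The part of a Lipschitz curve where `μ` is sparse at some scale has small measure. -/
theorem measure_sparse_le {α : Type*} [PseudoMetricSpace α] [MeasurableSpace α] (μ : Measure α)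
    {f : ℝ → α} {K : ℝ≥0} (hf : LipschitzWith K f) (a b : ℝ) {ε : ℝ} (hε : 0 ≤ ε) :
    μ {x ∈ f '' Icc a b | ∃ r, 0 < r ∧ r ≤ 1 ∧ μ (closedBall x r) ≤ ENNReal.ofReal (ε * r)} ≤
      ENNReal.ofReal ε * ENNReal.ofReal (5 * (K + 1) * (b + 1 - (a - 1))) := by
  let t : Set ℝ := {s ∈ Icc a b | ∃ r, 0 < r ∧ r ≤ 1 ∧
    μ (closedBall (f s) r) ≤ ENNReal.ofReal (ε * r)}
  have hch : ∀ s ∈ t, ∃ r, 0 < r ∧ r ≤ 1 ∧ μ (closedBall (f s) r) ≤ ENNReal.ofReal (ε * r) :=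
    fun s hs => hs.2
  choose! r hr hr1 hrμ using hch
  have hK : (0 : ℝ) < K + 1 := by positivity
  obtain ⟨u, hut, hdisj, hcov⟩ := Vitali.exists_disjoint_subfamily_covering_enlargement_closedBall
    t f (fun s => r s / 5) 1 (fun s hs => by linarith [hr1 s hs]) 5 (by norm_num)
  let I : ℝ → Set ℝ := fun s => closedBall s (r s / (5 * (K + 1)))
  have hI0 : ∀ s ∈ u, 0 < r s / (5 * (K + 1)) := fun s hs => div_pos (hr s (hut hs)) (by positivity)
  have hI : ∀ s ∈ u, I s ⊆ f ⁻¹' closedBall (f s) (r s / 5) := by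
    intro s hs v hv
    have h1 : dist v s ≤ r s / (5 * (K + 1)) := hv
    have h2 := hf.dist_le_mul v s
    rw [mem_preimage, mem_closedBall]
    have h3 : dist v s * (5 * (K + 1)) ≤ r s := (le_div_iff₀ (by positivity)).1 h1
    have : 0 ≤ dist v s := dist_nonneg
    linarith
  have hIdisj : u.PairwiseDisjoint I := fun s hs s' hs' hne =>
    ((hdisj hs hs' hne).preimage f).mono (hI s hs) (hI s' hs')
  have hucount : u.Countable := hIdisj.countable_of_nonempty_interior fun s hs => by
    rw [interior_closedBall _ (hI0 s hs).ne']
    exact ⟨s, mem_ball_self (hI0 s hs)⟩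
  have hsub : {x ∈ f '' Icc a b | ∃ r, 0 < r ∧ r ≤ 1 ∧
      μ (closedBall x r) ≤ ENNReal.ofReal (ε * r)} ⊆ ⋃ s ∈ u, closedBall (f s) (r s) := by
    rintro _ ⟨⟨s, hs, rfl⟩, h⟩
    have hst : s ∈ t := ⟨hs, h⟩
    obtain ⟨s', hs', hss'⟩ := hcov s hst
    have := hss' (mem_closedBall_self (by linarith [hr s hst]))
    rw [mul_div_cancel₀ _ (by norm_num : (5 : ℝ) ≠ 0)] at this
    exact mem_biUnion hs' this
  have hvol : ∑' s : u, volume (I s) ≤ ENNReal.ofReal (b + 1 - (a - 1)) := by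
    rw [← measure_biUnion hucount hIdisj fun s _ => measurableSet_closedBall, ← Real.volume_Icc]
    refine measure_mono (iUnion₂_subset fun s hs v hv => ?_)
    have h1 : |v - s| ≤ r s / (5 * (K + 1)) := hv
    have h2 : r s / (5 * (K + 1)) ≤ 1 := by
      rw [div_le_one (by positivity)]
      have := hr1 s (hut hs)
      have := K.coe_nonneg
      linarith
    have h3 := (hut hs).1
    rw [abs_le] at h1
    exact ⟨by linarith [h3.1], by linarith [h3.2]⟩
  calc _ ≤ μ (⋃ s ∈ u, closedBall (f s) (r s)) := measure_mono hsub
    _ ≤ ∑' s : u, μ (closedBall (f s) (r s)) := measure_biUnion_le _ hucount _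
    _ ≤ ∑' s : u, ENNReal.ofReal ε * (ENNReal.ofReal (5 * (K + 1)) * volume (I s)) := by
        refine ENNReal.tsum_le_tsum fun s => ?_
        refine (hrμ s (hut s.2)).trans ?_
        rw [Real.volume_closedBall, ← ENNReal.ofReal_mul (by positivity), ← ENNReal.ofReal_mul hε]
        apply ENNReal.ofReal_le_ofReal
        gcongr
        rw [mul_left_comm, mul_div_cancel₀ _ (by positivity)]
        linarith [hr s (hut s.2)]
    _ ≤ _ := by
        rw [ENNReal.tsum_mul_left, ENNReal.tsum_mul_left,
          ENNReal.ofReal_mul (p := 5 * (K + 1)) (by positivity)]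
        gcongr

/-- A measure has positive lower density at almost every point of a Lipschitz curve. -/
theorem measure_diff_lower_regular {α : Type*} [PseudoMetricSpace α] [MeasurableSpace α]
    (μ : Measure α) {f : ℝ → α} {K : ℝ≥0} (hf : LipschitzWith K f) (a b : ℝ) :
    μ (f '' Icc a b \ ⋃ j : ℕ, {x | ∀ r, 0 < r → r ≤ 1 →
      ENNReal.ofReal ((1 / 2) ^ j * r) ≤ μ (closedBall x r)}) = 0 := by
  have h : ∀ j : ℕ, μ (f '' Icc a b \ ⋃ j : ℕ, {x | ∀ r, 0 < r → r ≤ 1 →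
      ENNReal.ofReal ((1 / 2) ^ j * r) ≤ μ (closedBall x r)}) ≤
      ENNReal.ofReal ((1 / 2) ^ j) * ENNReal.ofReal (5 * (K + 1) * (b + 1 - (a - 1))) := by
    intro j
    refine (measure_mono ?_).trans (measure_sparse_le μ hf a b (by positivity))
    rintro x ⟨hx, hx'⟩
    simp only [mem_iUnion, not_exists, mem_ofPred_eq] at hx'
    refine ⟨hx, ?_⟩
    have := hx' j
    push Not at this
    obtain ⟨r, h1, h2, h3⟩ := this
    exact ⟨r, h1, h2, h3.le⟩
  refine le_antisymm (ge_of_tendsto' (x := atTop) ?_ h) zero_le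
  have h1 : Tendsto (fun j : ℕ => ENNReal.ofReal ((1 / 2) ^ j)) atTop (𝓝 0) := by
    rw [← ENNReal.ofReal_zero]
    exact ENNReal.tendsto_ofReal (tendsto_pow_atTop_nhds_zero_of_lt_one (by norm_num) (by norm_num))
  have h2 := ENNReal.Tendsto.mul_const (b := ENNReal.ofReal (5 * (K + 1) * (b + 1 - (a - 1)))) h1
    (Or.inr ENNReal.ofReal_ne_top)
  rwa [zero_mul] at h2

theorem dist_le_of_forall_abs_le {n : ℕ} {x y : EuclideanSpace ℝ (Fin n)} {d : ℝ} (hd : 0 ≤ d)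
    (h : ∀ i, |x i - y i| ≤ d) : dist x y ≤ n * d := by
  rw [EuclideanSpace.dist_eq]
  apply Real.sqrt_le_iff.2 ⟨by positivity, ?_⟩
  calc ∑ i, dist (x i) (y i) ^ 2 ≤ ∑ _i : Fin n, d ^ 2 :=
        Finset.sum_le_sum fun i _ => pow_le_pow_left₀ dist_nonneg (h i) 2
    _ = n * d ^ 2 := by simp
    _ ≤ (n * d) ^ 2 := by
      rw [mul_pow]
      gcongr
      exact_mod_cast Nat.le_self_pow two_ne_zero n

theorem measurableSet_dyadicCube (n : ℕ) (k : ℤ) (z : Fin n → ℤ) :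
    MeasurableSet (dyadicCube n k z) := by
  apply IsClosed.measurableSet
  simp only [dyadicCube, ofPred_forall, ofPred_and]
  exact isClosed_iInter fun i => (isClosed_le (by fun_prop) (by fun_prop)).inter
    (isClosed_le (by fun_prop) (by fun_prop))

theorem measurableSet_dilatedCube (n : ℕ) (lam : ℝ) (k : ℤ) (z : Fin n → ℤ) :
    MeasurableSet (dilatedCube n lam k z) := by
  apply IsClosed.measurableSet
  simp only [dilatedCube, ofPred_forall]
  exact isClosed_iInter fun i => isClosed_le (by fun_prop) (by fun_prop)

theorem dist_le_of_mem_dyadicCube {n : ℕ} {k : ℤ} {z : Fin n → ℤ} {x y : EuclideanSpace ℝ (Fin n)}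
    (hx : x ∈ dyadicCube n k z) (hy : y ∈ dyadicCube n k z) : dist x y ≤ n * 2 ^ (-k) := by
  refine dist_le_of_forall_abs_le (by positivity) fun i => ?_
  have h1 := hx i
  have h2 := hy i
  rw [abs_le]
  constructor <;> linarith

theorem dist_le_of_mem_dilatedCube {n : ℕ} {k : ℤ} {z : Fin n → ℤ} {x y : EuclideanSpace ℝ (Fin n)}
    (hx : x ∈ dilatedCube n 3 k z) (hy : y ∈ dilatedCube n 3 k z) :
    dist x y ≤ 3 * n * 2 ^ (-k) := by
  rw [mul_comm 3, mul_assoc]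
  refine dist_le_of_forall_abs_le (by positivity) fun i => ?_
  have h1 := abs_le.1 (hx i)
  have h2 := abs_le.1 (hy i)
  rw [abs_le]
  constructor <;> linarith

theorem closedBall_subset_dilatedCube {n : ℕ} {k : ℤ} {z : Fin n → ℤ}
    {x : EuclideanSpace ℝ (Fin n)} (hx : x ∈ dyadicCube n k z) :
    closedBall x (2 ^ (-k)) ⊆ dilatedCube n 3 k z := by
  intro y hy i
  have h1 := hx i
  have h2 := abs_le.1 ((abs_apply_sub_le_dist y x i).trans hy)
  rw [abs_le]
  constructor <;> linarith

theorem dyadicCube_subset_dilatedCube (n : ℕ) (k : ℤ) (z : Fin n → ℤ) :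
    dyadicCube n k z ⊆ dilatedCube n 3 k z := fun _ hx =>
  closedBall_subset_dilatedCube hx (mem_closedBall_self (by positivity))

theorem isBounded_dilatedCube (n : ℕ) (k : ℤ) (z : Fin n → ℤ) :
    Bornology.IsBounded (dilatedCube n 3 k z) :=
  isBounded_iff.2 ⟨_, fun _ hx _ hy => dist_le_of_mem_dilatedCube hx hy⟩

theorem diam_dyadicCube_le (n : ℕ) (k : ℤ) (z : Fin n → ℤ) :
    diam (dyadicCube n k z) ≤ n * 2 ^ (-k) :=
  diam_le_of_forall_dist_le (by positivity) fun _ hx _ hy => dist_le_of_mem_dyadicCube hx hy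

theorem le_diam_dilatedCube {n : ℕ} (hn : 0 < n) {k : ℤ} {z : Fin n → ℤ}
    {x : EuclideanSpace ℝ (Fin n)} (hx : x ∈ dyadicCube n k z) :
    (2 : ℝ) ^ (-k) ≤ diam (dilatedCube n 3 k z) := by
  have h2 : (0 : ℝ) < 2 ^ (-k) := by positivity
  have hd : dist (x + EuclideanSpace.single ⟨0, hn⟩ ((2 : ℝ) ^ (-k))) x = 2 ^ (-k) := by
    rw [dist_eq_norm, add_sub_cancel_left, PiLp.norm_single, Real.norm_of_nonneg h2.le]
  rw [← hd]
  exact dist_le_diam_of_mem (isBounded_dilatedCube n k z)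
    (closedBall_subset_dilatedCube hx (by rw [mem_closedBall, hd]))
    (dyadicCube_subset_dilatedCube n k z hx)

/-- Comparison of the `L²` beta number with the flatness of a curve through the cube. -/
theorem beta2Sq_mul_diam_le {n : ℕ} (hn : 0 < n) (μ : Measure (EuclideanSpace ℝ (Fin n)))
    [IsLocallyFiniteMeasure μ] {Γ L : Set (EuclideanSpace ℝ (Fin n))} (hΓ : IsCompact Γ)
    (hL : IsLine L) {k : ℤ} {z : Fin n → ℤ} {x : EuclideanSpace ℝ (Fin n)}
    (hx : x ∈ dyadicCube n k z) (hxΓ : x ∈ Γ) {w ε : ℝ} (hε : 0 < ε)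
    (hμ : ENNReal.ofReal (ε * 2 ^ (-k)) ≤ μ (closedBall x (2 ^ (-k))))
    (hΓL : ∀ p ∈ Γ, dist p x ≤ 6 * n * 2 ^ (-k) → infDist p L ≤ w * (6 * n * 2 ^ (-k))) :
    beta2Sq μ (dilatedCube n 3 k z) * ENNReal.ofReal (diam (dyadicCube n k z)) ≤
      ENNReal.ofReal (12 * n ^ 2) * ENNReal.ofReal (w ^ 2 * (6 * n * 2 ^ (-k))) +
      ENNReal.ofReal (2 * n / ε) *
        ∫⁻ y in dilatedCube n 3 k z, ENNReal.ofReal ((infDist y Γ / 2 ^ (-k)) ^ 2) ∂μ := by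
  set h : ℝ := 2 ^ (-k) with hh
  have h0 : 0 < h := by positivity
  set T := dilatedCube n 3 k z with hT
  have hTm : MeasurableSet T := measurableSet_dilatedCube n 3 k z
  have hμT : ENNReal.ofReal (ε * h) ≤ μ T :=
    hμ.trans (measure_mono (closedBall_subset_dilatedCube hx))
  have hμT0 : μ T ≠ 0 := by
    intro h1
    rw [h1] at hμT
    simp only [nonpos_iff_eq_zero, ENNReal.ofReal_eq_zero] at hμT
    have : 0 < ε * h := by positivity
    linarith
  have hμT1 : μ T ≠ ⊤ := (isBounded_dilatedCube n k z).measure_lt_top.ne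
  have hpt : ∀ y ∈ T, ENNReal.ofReal ((infDist y L / diam T) ^ 2) ≤
      ENNReal.ofReal (72 * n ^ 2 * w ^ 2) +
        ENNReal.ofReal 2 * ENNReal.ofReal ((infDist y Γ / h) ^ 2) := by
    intro y hy
    rw [← ENNReal.ofReal_mul (by norm_num), ← ENNReal.ofReal_add (by positivity) (by positivity)]
    apply ENNReal.ofReal_le_ofReal
    obtain ⟨g, hg, hgd⟩ := hΓ.exists_infDist_eq_dist ⟨x, hxΓ⟩ y
    have h1 : dist y x ≤ 3 * n * h :=
      dist_le_of_mem_dilatedCube hy (dyadicCube_subset_dilatedCube n k z hx)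
    have h2 : infDist y Γ ≤ dist y x := infDist_le_dist_of_mem hxΓ
    have h3 : dist g x ≤ 6 * n * h := by
      have := dist_triangle_left g x y
      linarith
    have h4 : infDist y L ≤ infDist g L + dist y g := infDist_le_infDist_add_dist
    have h5 := hΓL g hg h3
    have h6 : infDist y L / diam T ≤ w * (6 * n) + infDist y Γ / h := by
      calc infDist y L / diam T ≤ infDist y L / h :=
            div_le_div_of_nonneg_left infDist_nonneg h0 (le_diam_dilatedCube hn hx)
        _ ≤ (w * (6 * n * h) + infDist y Γ) / h := by gcongr; linarith
        _ = _ := by field_simp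
    have h7 : 0 ≤ infDist y L / diam T := div_nonneg infDist_nonneg diam_nonneg
    nlinarith [sq_nonneg (w * (6 * n) - infDist y Γ / h), pow_le_pow_left₀ h7 h6 2]
  have hint : ∫⁻ y in T, ENNReal.ofReal ((infDist y L / diam T) ^ 2) ∂μ ≤
      ENNReal.ofReal (72 * n ^ 2 * w ^ 2) * μ T +
        ENNReal.ofReal 2 * ∫⁻ y in T, ENNReal.ofReal ((infDist y Γ / h) ^ 2) ∂μ := by
    refine (setLIntegral_mono' hTm hpt).trans_eq ?_
    rw [lintegral_add_left measurable_const, setLIntegral_const,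
      lintegral_const_mul' _ _ ENNReal.ofReal_ne_top]
  set I := ∫⁻ y in T, ENNReal.ofReal ((infDist y Γ / h) ^ 2) ∂μ with hI
  have hεh : (0 : ℝ) < ε * h := by positivity
  calc _ ≤ (ENNReal.ofReal (72 * n ^ 2 * w ^ 2) * μ T + ENNReal.ofReal 2 * I) / μ T *
        ENNReal.ofReal (n * h) := by
        gcongr
        · exact (iInf₂_le L hL).trans (ENNReal.div_le_div_right hint _)
        · exact diam_dyadicCube_le n k z
    _ = ENNReal.ofReal (72 * n ^ 2 * w ^ 2) * ENNReal.ofReal (n * h) +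
        ENNReal.ofReal 2 * I / μ T * ENNReal.ofReal (n * h) := by
        rw [ENNReal.add_div, ENNReal.mul_div_cancel_right hμT0 hμT1, add_mul]
    _ ≤ ENNReal.ofReal (72 * n ^ 2 * w ^ 2) * ENNReal.ofReal (n * h) +
        ENNReal.ofReal 2 * I / ENNReal.ofReal (ε * h) * ENNReal.ofReal (n * h) := by
        gcongr
    _ = _ := by
        congr 1
        · rw [← ENNReal.ofReal_mul (by positivity), ← ENNReal.ofReal_mul (by positivity)]
          congr 1; ring
        · rw [div_eq_mul_inv, ← ENNReal.ofReal_inv_of_pos hεh, mul_right_comm _ I, mul_right_comm,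
            ← ENNReal.ofReal_mul (by positivity), ← ENNReal.ofReal_mul (by positivity)]
          congr 2
          field_simp

theorem beta2Sq_dilatedCube_lt_top {n : ℕ} (hn : 0 < n) (μ : Measure (EuclideanSpace ℝ (Fin n)))
    [IsLocallyFiniteMeasure μ] {k : ℤ} {z : Fin n → ℤ} (hμ : μ (dyadicCube n k z) ≠ 0) :
    beta2Sq μ (dilatedCube n 3 k z) < ⊤ := by
  obtain ⟨x, hx⟩ := nonempty_of_measure_ne_zero hμ
  set T := dilatedCube n 3 k z with hT
  have hxT : x ∈ T := dyadicCube_subset_dilatedCube n k z hx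
  have hL : IsLine {y : EuclideanSpace ℝ (Fin n) |
      ∃ t : ℝ, y = x + t • EuclideanSpace.single ⟨0, hn⟩ (1 : ℝ)} :=
    ⟨x, _, by simp, rfl⟩
  set L := {y : EuclideanSpace ℝ (Fin n) |
      ∃ t : ℝ, y = x + t • EuclideanSpace.single ⟨0, hn⟩ (1 : ℝ)} with hLdef
  have hxL : x ∈ L := ⟨0, by simp⟩
  have hμT0 : μ T ≠ 0 := fun h =>
    hμ (measure_mono_null (dyadicCube_subset_dilatedCube n k z) h)
  refine (iInf₂_le L hL).trans_lt (ENNReal.div_lt_top (ne_of_lt ?_) hμT0)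
  refine (setLIntegral_mono' (measurableSet_dilatedCube n 3 k z)
    (g := fun _ => ENNReal.ofReal ((3 * n * 2 ^ (-k) / diam T) ^ 2)) fun y hy => ?_).trans_lt ?_
  · apply ENNReal.ofReal_le_ofReal
    have h1 := (infDist_le_dist_of_mem (x := y) hxL).trans (dist_le_of_mem_dilatedCube hy hxT)
    have h2 : 0 ≤ diam T := diam_nonneg
    have h3 : 0 ≤ infDist y L := infDist_nonneg
    gcongr
  · rw [setLIntegral_const]
    exact ENNReal.mul_lt_top ENNReal.ofReal_lt_top (isBounded_dilatedCube n k z).measure_lt_top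

theorem sum_sq_scales_le {d R : ℝ} (hd : 0 ≤ d) (m : ℕ) :
    ∑ k ∈ Finset.range m, (if d / 2 ^ (-(k : ℤ)) ≤ R then (d / 2 ^ (-(k : ℤ))) ^ 2 else 0) ≤
      2 * R ^ 2 := by
  have ha : ∀ k : ℕ, d / 2 ^ (-(k : ℤ)) = d * 2 ^ k := fun k => by
    rw [zpow_neg, div_inv_eq_mul, zpow_natCast]
  simp_rw [ha]
  suffices h : ∑ k ∈ Finset.range m, (if d * 2 ^ k ≤ R then (d * 2 ^ k) ^ 2 else 0) ≤
      (d * 2 ^ m) ^ 2 ∧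
      ∑ k ∈ Finset.range m, (if d * 2 ^ k ≤ R then (d * 2 ^ k) ^ 2 else 0) ≤ 2 * R ^ 2 from h.2
  induction m with
  | zero => simp only [Finset.range_zero, Finset.sum_empty]; constructor <;> positivity
  | succ m ih =>
    obtain ⟨h1, h2⟩ := ih
    rw [Finset.sum_range_succ]
    have h3 : 0 ≤ d * 2 ^ m := by positivity
    have h4 : (d * 2 ^ (m + 1)) ^ 2 = 4 * (d * 2 ^ m) ^ 2 := by ring
    rw [h4]
    split_ifs with h
    · have h5 := pow_le_pow_left₀ h3 h 2
      constructor <;> linarith [sq_nonneg (d * 2 ^ m)]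
    · constructor <;> linarith [sq_nonneg (d * 2 ^ m)]

/-- The sum over all scales of the normalized square deviations from `Γ` is finite. -/
theorem tsum_lintegral_infDist_lt_top {n : ℕ} (μ : Measure (EuclideanSpace ℝ (Fin n)))
    [IsLocallyFiniteMeasure μ] {Γ : Set (EuclideanSpace ℝ (Fin n))} (hΓ : IsCompact Γ)
    (S : Set (ℕ × (Fin n → ℤ))) (hS : ∀ Q ∈ S, (Γ ∩ dyadicCube n Q.1 Q.2).Nonempty) :
    ∑' Q : S, ∫⁻ y in dilatedCube n 3 Q.1.1 Q.1.2,
      ENNReal.ofReal ((infDist y Γ / 2 ^ (-(Q.1.1 : ℤ))) ^ 2) ∂μ < ⊤ := by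
  classical
  obtain ⟨N, hN⟩ := exists_finset_dyadicCube n (3 * n)
  obtain ⟨R, hR⟩ := hΓ.isBounded.subset_closedBall 0
  set B : Set (EuclideanSpace ℝ (Fin n)) := closedBall 0 (R + 3 * n) with hB
  have hdist : ∀ Q ∈ S, ∀ y ∈ dilatedCube n 3 (Q.1 : ℤ) Q.2, ∃ x ∈ Γ ∩ dyadicCube n Q.1 Q.2,
      dist y x ≤ 3 * n * 2 ^ (-(Q.1 : ℤ)) := by
    intro Q hQ y hy
    obtain ⟨x, hx⟩ := hS Q hQ
    exact ⟨x, hx, dist_le_of_mem_dilatedCube hy (dyadicCube_subset_dilatedCube n _ _ hx.2)⟩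
  let φ : ℕ × (Fin n → ℤ) → EuclideanSpace ℝ (Fin n) → ℝ≥0∞ := fun Q y =>
    (dilatedCube n 3 Q.1 Q.2).indicator
      (fun y => ENNReal.ofReal ((infDist y Γ / 2 ^ (-(Q.1 : ℤ))) ^ 2)) y
  have hφm : ∀ Q, Measurable (φ Q) := fun Q => by
    refine Measurable.indicator ?_ (measurableSet_dilatedCube n 3 _ _)
    exact (((continuous_infDist_pt Γ).div_const _).pow 2).measurable.ennreal_ofReal
  have hpt : ∀ y, ∑' Q : S, φ Q y ≤
      B.indicator (fun _ => (N : ℝ≥0∞) * ENNReal.ofReal (2 * (3 * n) ^ 2)) y := by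
    intro y
    by_cases hy : y ∈ B
    · rw [indicator_of_mem hy]
      have hlevel : ∀ k : ℕ, ∑' z, S.indicator (fun Q => φ Q y) (k, z) ≤
          N * ENNReal.ofReal (if infDist y Γ / 2 ^ (-(k : ℤ)) ≤ 3 * n then
            (infDist y Γ / 2 ^ (-(k : ℤ))) ^ 2 else 0) := by
        intro k
        obtain ⟨Z, hZ, hZ'⟩ := hN k y
        have hz : ∀ z, S.indicator (fun Q => φ Q y) (k, z) ≤ if z ∈ Z then
            ENNReal.ofReal (if infDist y Γ / 2 ^ (-(k : ℤ)) ≤ 3 * n then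
            (infDist y Γ / 2 ^ (-(k : ℤ))) ^ 2 else 0) else 0 := by
          intro z
          by_cases hQS : (k, z) ∈ S
          swap; · rw [indicator_of_notMem hQS]; exact zero_le
          rw [indicator_of_mem hQS]
          by_cases hyQ : y ∈ dilatedCube n 3 (k : ℤ) z
          swap; · simp only [φ, indicator_of_notMem hyQ]; exact zero_le
          obtain ⟨x, hx, hxd⟩ := hdist _ hQS y hyQ
          rw [if_pos (hZ' z x hx.2 (by rw [dist_comm]; exact hxd)), if_pos]
          · simp only [φ, indicator_of_mem hyQ]; exact le_rfl
          · rw [div_le_iff₀ (by positivity)]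
            exact (infDist_le_dist_of_mem hx.1).trans hxd
        refine (ENNReal.tsum_le_tsum hz).trans ?_
        rw [tsum_eq_sum (s := Z) fun z hz => if_neg hz, Finset.sum_congr rfl fun z hz => if_pos hz,
          Finset.sum_const, nsmul_eq_mul]
        gcongr
      calc ∑' Q : S, φ Q y = ∑' Q, S.indicator (fun Q => φ Q y) Q :=
            tsum_subtype S fun Q => φ Q y
        _ = ∑' k, ∑' z, S.indicator (fun Q => φ Q y) (k, z) := ENNReal.tsum_prod'
        _ ≤ ∑' k : ℕ, N * ENNReal.ofReal (if infDist y Γ / 2 ^ (-(k : ℤ)) ≤ 3 * n then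
            (infDist y Γ / 2 ^ (-(k : ℤ))) ^ 2 else 0) := ENNReal.tsum_le_tsum hlevel
        _ ≤ _ := by
          rw [ENNReal.tsum_mul_left]
          gcongr
          rw [ENNReal.tsum_eq_iSup_nat]
          refine iSup_le fun m => ?_
          rw [← ENNReal.ofReal_sum_of_nonneg fun k _ => by split_ifs <;> positivity]
          exact ENNReal.ofReal_le_ofReal (sum_sq_scales_le infDist_nonneg m)
    · rw [indicator_of_notMem hy, nonpos_iff_eq_zero, ENNReal.tsum_eq_zero]
      intro Q
      refine indicator_of_notMem (fun hyQ => hy ?_) _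
      obtain ⟨x, hx, hxd⟩ := hdist _ Q.2 y hyQ
      have h1 : dist x 0 ≤ R := hR hx.1
      have h2 : (2 : ℝ) ^ (-(Q.1.1 : ℤ)) ≤ 1 := zpow_le_one_of_nonpos₀ (by norm_num) (by simp)
      have h3 : 3 * n * (2 : ℝ) ^ (-(Q.1.1 : ℤ)) ≤ 3 * n := mul_le_of_le_one_right (by positivity) h2
      rw [hB, mem_closedBall]
      have := dist_triangle y x 0
      linarith
  calc _ = ∑' Q : S, ∫⁻ y, φ Q y ∂μ := by
        refine tsum_congr fun Q => ?_
        exact (lintegral_indicator (measurableSet_dilatedCube n 3 _ _) _).symm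
    _ = ∫⁻ y, ∑' Q : S, φ Q y ∂μ := (lintegral_tsum fun Q : S => (hφm Q).aemeasurable).symm
    _ ≤ ∫⁻ y, B.indicator (fun _ => (N : ℝ≥0∞) * ENNReal.ofReal (2 * (3 * n) ^ 2)) y ∂μ :=
        lintegral_mono hpt
    _ = N * ENNReal.ofReal (2 * (3 * n) ^ 2) * μ B := lintegral_indicator_const
        measurableSet_closedBall _
    _ < ⊤ := ENNReal.mul_lt_top (ENNReal.mul_lt_top (ENNReal.natCast_lt_top N)
        ENNReal.ofReal_lt_top) measure_closedBall_lt_top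

/-- The coefficient of the indicator of a dyadic cube in the density-normalized Jones function. -/
def jonesCoeff {n : ℕ} (μ : Measure (EuclideanSpace ℝ (Fin n))) (k : ℤ) (z : Fin n → ℤ) : ℝ≥0∞ :=
  beta2Sq μ (dilatedCube n 3 k z) * ENNReal.ofReal (diam (dyadicCube n k z)) /
    μ (dyadicCube n k z)

theorem tsum_indicator_jonesCoeff_lt_top {n : ℕ} (hn : 0 < n)
    (μ : Measure (EuclideanSpace ℝ (Fin n))) [IsLocallyFiniteMeasure μ] (k : ℤ)
    (x : EuclideanSpace ℝ (Fin n)) :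
    ∑' z, (dyadicCube n k z).indicator
      (fun _ => if μ (dyadicCube n k z) = 0 then 0 else jonesCoeff μ k z) x < ⊤ := by
  obtain ⟨N, hN⟩ := exists_finset_dyadicCube n 0
  obtain ⟨Z, -, hZ⟩ := hN k x
  rw [tsum_eq_sum (s := Z) fun z hz => indicator_of_notMem
    (fun hx => hz (hZ z x hx (by simp))) _]
  refine ENNReal.sum_lt_top.2 fun z _ => ?_
  by_cases hx : x ∈ dyadicCube n k z
  · rw [indicator_of_mem hx]
    split_ifs with hμ
    · exact ENNReal.zero_lt_top
    · exact ENNReal.div_lt_top (ENNReal.mul_lt_top (beta2Sq_dilatedCube_lt_top hn μ hμ)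
        ENNReal.ofReal_lt_top).ne hμ
  · rw [indicator_of_notMem hx]
    exact ENNReal.zero_lt_top

theorem jones2Tilde_le {n : ℕ} (μ : Measure (EuclideanSpace ℝ (Fin n)))
    (k₀ : ℕ) (x : EuclideanSpace ℝ (Fin n)) :
    jones2Tilde μ 1 x ≤ (∑ k ∈ Finset.range k₀, ∑' z, (dyadicCube n k z).indicator
      (fun _ => if μ (dyadicCube n k z) = 0 then 0 else jonesCoeff μ k z) x) +
      ∑' Q : {Q : ℕ × (Fin n → ℤ) | k₀ ≤ Q.1}, (dyadicCube n Q.1.1 Q.1.2).indicator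
        (fun _ => if μ (dyadicCube n Q.1.1 Q.1.2) = 0 then 0 else jonesCoeff μ Q.1.1 Q.1.2) x := by
  classical
  set g : ℕ → (Fin n → ℤ) → ℝ≥0∞ := fun k z => (dyadicCube n k z).indicator
      (fun _ => if μ (dyadicCube n k z) = 0 then 0 else jonesCoeff μ k z) x with hg
  have h1 : jones2Tilde μ 1 x = ∑' k : ℕ, ∑' z, g k z := by
    unfold jones2Tilde
    rw [← (Nat.cast_injective (R := ℤ)).tsum_eq]
    · refine tsum_congr fun k => tsum_congr fun z => ?_
      have h2 : (2 : ℝ) ^ (-(k : ℤ)) ≤ 1 := zpow_le_one_of_nonpos₀ (by norm_num) (by simp)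
      simp only [hg, indicator_apply, h2, true_and, jonesCoeff]
    · intro k hk
      by_contra hk'
      apply hk
      have hneg : ¬ (2 : ℝ) ^ (-k) ≤ 1 := by
        rw [not_le]
        apply one_lt_zpow₀ (by norm_num)
        by_contra h
        exact hk' ⟨k.toNat, by simp; omega⟩
      simp only [hneg, false_and, if_false, tsum_zero]
  rw [h1, ← ENNReal.summable.sum_add_tsum_nat_add' (f := fun k => ∑' z, g k z) (k := k₀)]
  gcongr
  rw [tsum_subtype {Q : ℕ × (Fin n → ℤ) | k₀ ≤ Q.1} fun Q => g Q.1 Q.2, ENNReal.tsum_prod',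
    ← ENNReal.summable.sum_add_tsum_nat_add' (f := fun k => ∑' z,
      {Q : ℕ × (Fin n → ℤ) | k₀ ≤ Q.1}.indicator (fun Q => g Q.1 Q.2) (k, z)) (k := k₀)]
  refine le_add_left (ENNReal.tsum_le_tsum fun k => ENNReal.tsum_le_tsum fun z => ?_)
  rw [indicator_of_mem (show (k + k₀, z) ∈ {Q : ℕ × (Fin n → ℤ) | k₀ ≤ Q.1} by simp)]

theorem ae_tail_lt_top {n : ℕ} (μ : Measure (EuclideanSpace ℝ (Fin n)))
    [IsLocallyFiniteMeasure μ] (E : Set (EuclideanSpace ℝ (Fin n))) (k₀ : ℕ)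
    (h : ∑' Q : {Q : ℕ × (Fin n → ℤ) | k₀ ≤ Q.1 ∧ (E ∩ dyadicCube n Q.1 Q.2).Nonempty},
      beta2Sq μ (dilatedCube n 3 Q.1.1 Q.1.2) *
        ENNReal.ofReal (diam (dyadicCube n Q.1.1 Q.1.2)) < ⊤) :
    ∀ᵐ x ∂μ, x ∈ E →
      ∑' Q : {Q : ℕ × (Fin n → ℤ) | k₀ ≤ Q.1}, (dyadicCube n Q.1.1 Q.1.2).indicator
        (fun _ => if μ (dyadicCube n Q.1.1 Q.1.2) = 0 then 0
          else jonesCoeff μ Q.1.1 Q.1.2) x < ⊤ := by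
  set S := {Q : ℕ × (Fin n → ℤ) | k₀ ≤ Q.1 ∧ (E ∩ dyadicCube n Q.1 Q.2).Nonempty} with hS
  have hm : ∀ Q : {Q : ℕ × (Fin n → ℤ) | k₀ ≤ Q.1}, Measurable fun x =>
      (dyadicCube n Q.1.1 Q.1.2).indicator
      (fun _ => if μ (dyadicCube n Q.1.1 Q.1.2) = 0 then 0 else jonesCoeff μ Q.1.1 Q.1.2) x :=
    fun Q => measurable_const.indicator (measurableSet_dyadicCube n _ _)
  have hmt : Measurable fun x => ∑' Q : {Q : ℕ × (Fin n → ℤ) | k₀ ≤ Q.1},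
      (dyadicCube n Q.1.1 Q.1.2).indicator (fun _ => if μ (dyadicCube n Q.1.1 Q.1.2) = 0 then 0
        else jonesCoeff μ Q.1.1 Q.1.2) x := .tsum hm
  refine (ae_restrict_iff (measurableSet_lt hmt measurable_const)).1 (ae_lt_top hmt (ne_of_lt ?_))
  rw [lintegral_tsum fun Q => (hm Q).aemeasurable]
  refine lt_of_le_of_lt ?_ h
  rw [tsum_subtype S fun Q => beta2Sq μ (dilatedCube n 3 Q.1 Q.2) *
    ENNReal.ofReal (diam (dyadicCube n Q.1 Q.2))]
  refine le_trans (ENNReal.tsum_le_tsum fun Q => ?_)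
    (ENNReal.tsum_comp_le_tsum_of_injective (Subtype.val_injective
      (p := fun Q => Q ∈ {Q : ℕ × (Fin n → ℤ) | k₀ ≤ Q.1})) _)
  obtain ⟨⟨k, z⟩, hk⟩ := Q
  have hD := measurableSet_dyadicCube n k z
  simp only
  rw [lintegral_indicator_const hD, Measure.restrict_apply hD]
  by_cases hQ : (k, z) ∈ S
  · rw [indicator_of_mem hQ]
    split_ifs with hμ
    · simp
    · refine (mul_le_mul_right (measure_mono inter_subset_left) _).trans ?_
      rw [jonesCoeff, ENNReal.div_mul_cancel hμ]
      exact ((isBounded_dilatedCube n k z).subset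
        (dyadicCube_subset_dilatedCube n k z)).measure_lt_top.ne
  · have : dyadicCube n k z ∩ E = ∅ := by
      rw [inter_comm]
      by_contra hne
      exact hQ ⟨hk, nonempty_iff_ne_empty.2 hne⟩
    rw [this, measure_empty, mul_zero]
    exact zero_le

theorem tsum_beta2Sq_lt_top {n : ℕ} (hn : 2 ≤ n) (μ : Measure (EuclideanSpace ℝ (Fin n)))
    [IsLocallyFiniteMeasure μ] {f : ℝ → EuclideanSpace ℝ (Fin n)} {K : ℝ≥0}
    (hf : LipschitzWith K f) {a b : ℝ} (hab : a < b) {E : Set (EuclideanSpace ℝ (Fin n))}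
    (hE : E ⊆ f '' Icc a b) {ε : ℝ} (hε : 0 < ε)
    (hreg : ∀ x ∈ E, ∀ r, 0 < r → r ≤ 1 → ENNReal.ofReal (ε * r) ≤ μ (closedBall x r)) {k₀ : ℕ}
    (hk₀ : ∀ x, ∃ y ∈ f '' Icc a b, 6 * (6 * n * 2 ^ (-(k₀ : ℤ))) ≤ dist y x) :
    ∑' Q : {Q : ℕ × (Fin n → ℤ) | k₀ ≤ Q.1 ∧ (E ∩ dyadicCube n Q.1 Q.2).Nonempty},
      beta2Sq μ (dilatedCube n 3 Q.1.1 Q.1.2) *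
        ENNReal.ofReal (diam (dyadicCube n Q.1.1 Q.1.2)) < ⊤ := by
  set S := {Q : ℕ × (Fin n → ℤ) | k₀ ≤ Q.1 ∧ (E ∩ dyadicCube n Q.1 Q.2).Nonempty} with hS
  have hn0 : 0 < n := by omega
  have hC : (0 : ℝ) < 6 * n := by positivity
  have hΓ : IsCompact (f '' Icc a b) := isCompact_Icc.image hf.continuous
  have hch : ∀ Q ∈ S, ∃ x, x ∈ E ∩ dyadicCube n Q.1 Q.2 := fun Q hQ => hQ.2
  choose! x hx using hch
  obtain ⟨L, w, hL, A, hA, hsum⟩ := exists_lines_of_lipschitz hn hf hab hC S x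
    (fun Q hQ => (hx Q hQ).2) (fun Q hQ => hE (hx Q hQ).1) (fun Q hQ => by
      obtain ⟨y, hy, hyd⟩ := hk₀ (x Q)
      refine ⟨y, hy, le_trans ?_ hyd⟩
      have : (2 : ℝ) ^ (-(Q.1 : ℤ)) ≤ 2 ^ (-(k₀ : ℤ)) :=
        zpow_le_zpow_right₀ (by norm_num) (by have := hQ.1; omega)
      gcongr)
  have hterm : ∀ Q : S, beta2Sq μ (dilatedCube n 3 Q.1.1 Q.1.2) *
      ENNReal.ofReal (diam (dyadicCube n Q.1.1 Q.1.2)) ≤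
      ENNReal.ofReal (12 * n ^ 2) *
        ENNReal.ofReal (w Q.1 ^ 2 * (6 * n * 2 ^ (-(Q.1.1 : ℤ)))) +
      ENNReal.ofReal (2 * n / ε) * ∫⁻ y in dilatedCube n 3 Q.1.1 Q.1.2,
        ENNReal.ofReal ((infDist y (f '' Icc a b) / 2 ^ (-(Q.1.1 : ℤ))) ^ 2) ∂μ := by
    rintro ⟨Q, hQ⟩
    have h2 : (2 : ℝ) ^ (-(Q.1 : ℤ)) ≤ 1 := zpow_le_one_of_nonpos₀ (by norm_num) (by simp)
    exact beta2Sq_mul_diam_le hn0 μ hΓ (hL Q hQ).1 (hx Q hQ).2 (hE (hx Q hQ).1) hε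
      (hreg _ (hx Q hQ).1 _ (by positivity) h2) (hL Q hQ).2
  refine (ENNReal.tsum_le_tsum hterm).trans_lt ?_
  rw [ENNReal.tsum_add, ENNReal.tsum_mul_left, ENNReal.tsum_mul_left]
  refine ENNReal.add_lt_top.2 ⟨ENNReal.mul_lt_top ENNReal.ofReal_lt_top ?_,
    ENNReal.mul_lt_top ENNReal.ofReal_lt_top (tsum_lintegral_infDist_lt_top μ hΓ S
      fun Q hQ => ⟨x Q, hE (hx Q hQ).1, (hx Q hQ).2⟩)⟩
  refine lt_of_le_of_lt ?_ hA.lt_top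
  rw [ENNReal.tsum_eq_iSup_sum]
  refine iSup_le fun F => ?_
  have := hsum (F.map (Function.Embedding.subtype _)) (by
    intro Q hQ
    obtain ⟨Q', -, rfl⟩ := Finset.mem_map.1 hQ
    exact Q'.2)
  rwa [Finset.sum_map] at this

theorem ae_mem_curve_jones2Tilde_lt_top {n : ℕ} (hn : 2 ≤ n)
    (μ : Measure (EuclideanSpace ℝ (Fin n))) [IsLocallyFiniteMeasure μ]
    {f : ℝ → EuclideanSpace ℝ (Fin n)} {K : ℝ≥0} (hf : LipschitzWith K f) {a b : ℝ} (hab : a < b)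
    (hne : ∃ s ∈ Icc a b, f s ≠ f a) :
    ∀ᵐ x ∂μ, x ∈ f '' Icc a b → jones2Tilde μ 1 x < ⊤ := by
  have hn0 : 0 < n := by omega
  obtain ⟨s, hs, hsa⟩ := hne
  obtain ⟨k₀, hk₀⟩ : ∃ k₀ : ℕ, 6 * (6 * n * (2 : ℝ) ^ (-(k₀ : ℤ))) ≤ dist (f s) (f a) / 2 := by
    have hd : 0 < dist (f s) (f a) / 2 / (36 * n) :=
      div_pos (half_pos (dist_pos.2 hsa)) (by positivity)
    obtain ⟨k, hk⟩ := exists_pow_lt_of_lt_one hd (by norm_num : (1 / 2 : ℝ) < 1)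
    refine ⟨k, ?_⟩
    rw [lt_div_iff₀ (by positivity)] at hk
    rw [zpow_neg, zpow_natCast, ← inv_pow, ← one_div]
    linarith
  have hfar : ∀ x, ∃ y ∈ f '' Icc a b, 6 * (6 * n * 2 ^ (-(k₀ : ℤ))) ≤ dist y x := by
    intro x
    by_contra! h
    have h1 := h (f s) (mem_image_of_mem f hs)
    have h2 := h (f a) (mem_image_of_mem f (left_mem_Icc.2 hab.le))
    have := dist_triangle_right (f s) (f a) x
    linarith
  let G : ℕ → Set (EuclideanSpace ℝ (Fin n)) := fun j => {x | ∀ r, 0 < r → r ≤ 1 →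
      ENNReal.ofReal ((1 / 2) ^ j * r) ≤ μ (closedBall x r)}
  have h1 : ∀ᵐ x ∂μ, x ∉ f '' Icc a b \ ⋃ j, G j :=
    measure_eq_zero_iff_ae_notMem.1 (measure_diff_lower_regular μ hf a b)
  have h2 : ∀ᵐ x ∂μ, ∀ j, x ∈ f '' Icc a b ∩ G j →
      ∑' Q : {Q : ℕ × (Fin n → ℤ) | k₀ ≤ Q.1}, (dyadicCube n Q.1.1 Q.1.2).indicator
        (fun _ => if μ (dyadicCube n Q.1.1 Q.1.2) = 0 then 0
          else jonesCoeff μ Q.1.1 Q.1.2) x < ⊤ :=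
    ae_all_iff.2 fun j => ae_tail_lt_top μ _ k₀ (tsum_beta2Sq_lt_top hn μ hf hab
      inter_subset_left (by positivity) (fun x hx => hx.2) hfar)
  filter_upwards [h1, h2] with x hx1 hx2 hx
  obtain ⟨j, hj⟩ : ∃ j, x ∈ G j := by
    by_contra h
    exact hx1 ⟨hx, fun h' => h (mem_iUnion.1 h')⟩
  exact (jones2Tilde_le μ k₀ x).trans_lt (ENNReal.add_lt_top.2
    ⟨ENNReal.sum_lt_top.2 fun k _ => tsum_indicator_jonesCoeff_lt_top hn0 μ k x,
      hx2 j ⟨hx, hj⟩⟩)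

/-- A Lipschitz image of a bounded subset of the line lies in a nondegenerate Lipschitz curve. -/
theorem exists_nondegenerate_curve {n : ℕ} (hn : 0 < n) {E : Set ℝ} (hE : Bornology.IsBounded E)
    {f : ℝ → EuclideanSpace ℝ (Fin n)} {K : ℝ≥0} (hf : LipschitzOnWith K f E) :
    ∃ (g : ℝ → EuclideanSpace ℝ (Fin n)) (K' : ℝ≥0) (a b : ℝ), LipschitzWith K' g ∧ a < b ∧
      (∃ s ∈ Icc a b, g s ≠ g a) ∧ f '' E ⊆ g '' Icc a b := by
  obtain ⟨g, hg, hgE⟩ := hf.extend_finite_dimension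
  obtain ⟨R, hR⟩ := hE.subset_closedBall 0
  rw [Real.closedBall_eq_Icc, zero_sub, zero_add] at hR
  have hR' : E ⊆ Icc (-|R|) (|R| + 1) := hR.trans (Icc_subset_Icc (neg_le_neg (le_abs_self R))
    ((le_abs_self R).trans (by linarith)))
  have hlt : -|R| < |R| + 1 := by have := abs_nonneg R; linarith
  have hfg : f '' E ⊆ g '' Icc (-|R|) (|R| + 1) := by
    rintro _ ⟨t, ht, rfl⟩
    exact ⟨t, hR' ht, (hgE ht).symm⟩
  by_cases hdeg : ∃ s ∈ Icc (-|R|) (|R| + 1), g s ≠ g (-|R|)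
  · exact ⟨g, _, _, _, hg, hlt, hdeg, hfg⟩
  · push Not at hdeg
    let e : EuclideanSpace ℝ (Fin n) := EuclideanSpace.single ⟨0, hn⟩ 1
    refine ⟨fun t => g (-|R|) + t • e, 1, 0, 1, ?_, one_pos, ⟨1, by simp, by simp [e]⟩, ?_⟩
    · refine LipschitzWith.of_dist_le_mul fun s t => ?_
      rw [dist_add_left, dist_eq_norm, ← sub_smul, norm_smul, Real.dist_eq]
      simp [e]
    · refine hfg.trans ?_
      rintro _ ⟨t, ht, rfl⟩
      exact ⟨0, by simp, by simp [hdeg t ht]⟩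

/-- If `n ≥ 2` and `μ` is a locally finite Borel measure on `ℝⁿ` which is
`1`-rectifiable, then `J̃₂(μ,x) < ∞` at `μ`-a.e. `x ∈ ℝⁿ`. -/
theorem jones2Tilde_lt_top_ae_of_is1Rectifiable (n : ℕ) (hn : 2 ≤ n)
    (μ : Measure (EuclideanSpace ℝ (Fin n))) [IsLocallyFiniteMeasure μ]
    (hμ : Is1Rectifiable μ) :
    ∀ᵐ x ∂μ, jones2Tilde μ 1 x < ⊤ := by
  obtain ⟨E, f, hEf, hcov⟩ := hμ
  have h1 : ∀ i, ∀ᵐ x ∂μ, x ∈ f i '' E i → jones2Tilde μ 1 x < ⊤ := by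
    intro i
    obtain ⟨hb, -, K, hK⟩ := hEf i
    obtain ⟨g, K', a, b, hg, hab, hne, hsub⟩ := exists_nondegenerate_curve (by omega) hb hK
    filter_upwards [ae_mem_curve_jones2Tilde_lt_top hn μ hg hab hne] with x hx hxE
    exact hx (hsub hxE)
  filter_upwards [ae_all_iff.2 h1, measure_eq_zero_iff_ae_notMem.1 hcov] with x hx hxc
  by_contra h
  refine hxc ⟨mem_univ x, fun hxU => h ?_⟩
  obtain ⟨i, hi⟩ := mem_iUnion.1 hxU
  exact hx i hi

end
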